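/- arXiv:0912.3242 — 2 statements merged into one kernel-verified Lean document; each statement's English description precedes it below -/
import Mathlib

section
/- Let M be a simple weight module over a simple complex Lie algebra g. Then every root α ∈ R is either locally nilpotent or cuspidal with respect to M, and not both; i.e. R = R^N(M) ⊔ R^I(M). -/
namespace Paper

open scoped Classical

open Module

variable {L : Type*} [LieRing L] [LieAlgebra ℂ L]

/-- The weight space of a Lie module `M` for a functional `α` on the subalgebra `H`. -/
def wSpace (H : LieSubalgebra ℂ L) {M : Type*} [AddCommGroup M] [Module ℂ M]
    [LieRingModule L M] [LieModule ℂ L M] (α : Module.Dual ℂ H) : Submodule ℂ M where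
  carrier := {m | ∀ h : H, ⁅(h : L), m⁆ = α h • m}
  add_mem' := by
    intro x y hx hy h
    rw [lie_add, hx h, hy h, smul_add]
  zero_mem' := by intro h; rw [lie_zero, smul_zero]
  smul_mem' := by
    intro c x hx h
    rw [lie_smul, hx h, smul_comm]

/-- The root space `g^α`. -/
def gSpace (H : LieSubalgebra ℂ L) (α : Module.Dual ℂ H) : Submodule ℂ L :=
  wSpace H α

/-- `α` is a root of `(L, H)` : a nonzero functional with nonzero root space. -/
def IsRoot (H : LieSubalgebra ℂ L) (α : Module.Dual ℂ H) : Prop :=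
  α ≠ 0 ∧ gSpace H α ≠ ⊥

/-- `Δ` is a base (set of simple roots) of the root system of `(L, H)`: a linearly
independent set of roots such that every root is a linear combination of elements of `Δ`
with coefficients that are all nonnegative integers or all nonpositive integers. -/
def IsBase (H : LieSubalgebra ℂ L) (Δ : Finset (Module.Dual ℂ H)) : Prop :=
  (∀ β ∈ Δ, IsRoot H β) ∧
  LinearIndependent ℂ (fun β : Δ => (β : Module.Dual ℂ H)) ∧
  ∀ α, IsRoot H α →
    (∃ c : Module.Dual ℂ H → ℕ, α = ∑ β ∈ Δ, (c β : ℂ) • β) ∨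
    (∃ c : Module.Dual ℂ H → ℕ, α = -∑ β ∈ Δ, (c β : ℂ) • β)

/-- `α` is a positive root with respect to the base `Δ`. -/
def IsPos (H : LieSubalgebra ℂ L) (Δ : Finset (Module.Dual ℂ H))
    (α : Module.Dual ℂ H) : Prop :=
  IsRoot H α ∧ ∃ c : Module.Dual ℂ H → ℕ, α = ∑ β ∈ Δ, (c β : ℂ) • β

/-- `α ∈ ⟨θ⟩` : `α` is a root which is a (ℤ-)linear combination of elements of `θ`. -/
def InSpan (H : LieSubalgebra ℂ L) (θ : Finset (Module.Dual ℂ H))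
    (α : Module.Dual ℂ H) : Prop :=
  IsRoot H α ∧ ∃ c : Module.Dual ℂ H → ℤ, α = ∑ β ∈ θ, (c β : ℂ) • β

/-- The nilradical `n⁺_θ = ⨁_{α ∈ R⁺ \ ⟨θ⟩⁺} g^α` (as a subspace of `L`). -/
def nPlus (H : LieSubalgebra ℂ L) (Δ θ : Finset (Module.Dual ℂ H)) : Submodule ℂ L :=
  ⨆ α ∈ {α | IsPos H Δ α ∧ ¬ InSpan H θ α}, gSpace H α

/-- The standard Levi subalgebra `l_θ = h ⊕ ⨁_{α ∈ ⟨θ⟩} g^α` (as a subspace of `L`). -/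
def levi (H : LieSubalgebra ℂ L) (θ : Finset (Module.Dual ℂ H)) : Submodule ℂ L :=
  (H : Submodule ℂ L) ⊔ ⨆ α ∈ {α | InSpan H θ α}, gSpace H α

/-- The standard parabolic subalgebra `p_θ = l_θ ⊕ n⁺_θ` (as a subspace of `L`). -/
def par (H : LieSubalgebra ℂ L) (Δ θ : Finset (Module.Dual ℂ H)) : Submodule ℂ L :=
  levi H θ ⊔ nPlus H Δ θ

section Modules

variable (H : LieSubalgebra ℂ L) (M : Type*) [AddCommGroup M] [Module ℂ M]
  [LieRingModule L M] [LieModule ℂ L M]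

/-- `M` is a weight module: finitely generated, `h`-diagonalizable, with
finite-dimensional weight spaces. -/
def IsWeightModule : Prop :=
  (∃ s : Finset M, LieSubmodule.lieSpan ℂ L (s : Set M) = ⊤) ∧
  (⨆ α : Module.Dual ℂ H, wSpace H (M := M) α) = ⊤ ∧
  ∀ α : Module.Dual ℂ H, FiniteDimensional ℂ (wSpace H (M := M) α)

/-- The root `α` is locally nilpotent with respect to `M`. -/
def IsLocallyNilpotentRoot (α : Module.Dual ℂ H) : Prop :=
  ∀ x ∈ gSpace H α, ∀ m : M, ∃ n : ℕ, ((LieModule.toEnd ℂ L M x) ^ n) m = 0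

/-- The root `α` is cuspidal (injective) with respect to `M`. -/
def IsCuspidalRoot (α : Module.Dual ℂ H) : Prop :=
  ∀ x ∈ gSpace H α, x ≠ 0 → Function.Injective (LieModule.toEnd ℂ L M x)

end Modules


lemma mem_rootSpace_of_gSpace {L : Type*} [LieRing L] [LieAlgebra ℂ L]
    (H : LieSubalgebra ℂ L) [LieRing.IsNilpotent H]
    (α : Module.Dual ℂ H) {x : L} (hx : x ∈ gSpace H α) :
    x ∈ LieAlgebra.rootSpace H (α : H → ℂ) := by
  apply LieModule.weightSpace_le_genWeightSpace
  rw [LieModule.mem_weightSpace]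
  intro h
  exact hx h

/-- The `x`-nilpotent vectors form a Lie submodule when `ad x` is nilpotent. -/
def nilSub {L : Type*} [LieRing L] [LieAlgebra ℂ L]
    (M : Type*) [AddCommGroup M] [Module ℂ M] [LieRingModule L M] [LieModule ℂ L M]
    (x : L) (hx : IsNilpotent (LieAlgebra.ad ℂ L x)) : LieSubmodule ℂ L M :=
  { (LieModule.toEnd ℂ L M x).maxGenEigenspace 0 with
    lie_mem := by
      intro y m hm
      have hy : y ∈ (LieModule.toEnd ℂ L L x).maxGenEigenspace 0 := by
        rw [Module.End.mem_maxGenEigenspace]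
        obtain ⟨k, hk⟩ := hx
        refine ⟨k, ?_⟩
        have h2 : (LieModule.toEnd ℂ L L x) ^ k = 0 := hk
        rw [zero_smul, sub_zero, h2, LinearMap.zero_apply]
      have := LieModule.lie_mem_maxGenEigenspace_toEnd (M := M) hy hm
      rw [add_zero] at this
      exact this }

lemma mem_nilSub {L : Type*} [LieRing L] [LieAlgebra ℂ L]
    (M : Type*) [AddCommGroup M] [Module ℂ M] [LieRingModule L M] [LieModule ℂ L M]
    (x : L) (hx : IsNilpotent (LieAlgebra.ad ℂ L x)) (m : M) :
    m ∈ nilSub M x hx ↔ ∃ n : ℕ, ((LieModule.toEnd ℂ L M x) ^ n) m = 0 := by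
  change m ∈ (LieModule.toEnd ℂ L M x).maxGenEigenspace 0 ↔ _
  rw [Module.End.mem_maxGenEigenspace]
  simp

/-- For a simple weight module `M`, every root is either locally
nilpotent or cuspidal, and not both: `R = R^N(M) ⊔ R^I(M)`. -/
theorem root_locallyNilpotent_xor_cuspidal
    {L : Type*} [LieRing L] [LieAlgebra ℂ L] [FiniteDimensional ℂ L]
    [LieAlgebra.IsSimple ℂ L]
    (H : LieSubalgebra ℂ L) [H.IsCartanSubalgebra]
    (Δ : Finset (Module.Dual ℂ H)) (hΔ : IsBase H Δ)
    (M : Type*) [AddCommGroup M] [Module ℂ M] [LieRingModule L M] [LieModule ℂ L M]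
    [LieModule.IsIrreducible ℂ L M] (hM : IsWeightModule H M) :
    ∀ α : Module.Dual ℂ H, IsRoot H α →
      Xor' (IsLocallyNilpotentRoot H M α) (IsCuspidalRoot H M α) := by
  intro α hα
  obtain ⟨hα0, hne⟩ := hα
  have hα0' : (α : H → ℂ) ≠ 0 := fun h => hα0 (by ext y; simpa using congrFun h y)
  have hnt : Nontrivial M := LieModule.nontrivial_of_isIrreducible ℂ L M
  obtain ⟨e, he, he0⟩ := (Submodule.ne_bot_iff _).mp hne
  have heR := mem_rootSpace_of_gSpace H α he
  have hnil : IsNilpotent (LieAlgebra.ad ℂ L e) :=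
    LieAlgebra.isNilpotent_ad_of_mem_rootSpace H hα0' heR
  let w : LieModule.Weight ℂ H L := ⟨α, by
    intro h
    rw [LieAlgebra.rootSpace, h] at heR
    exact he0 (by simpa using heR)⟩
  have hw : w.IsNonZero := fun h => hα0' h
  have h1 := LieAlgebra.IsKilling.finrank_rootSpace_eq_one w hw
  have hspan : ∀ x ∈ gSpace H α, ∃ c : ℂ, c • e = x := by
    intro x hx
    have hxR := mem_rootSpace_of_gSpace H α hx
    obtain ⟨c, hc⟩ := (finrank_eq_one_iff_of_nonzero'
      (⟨e, heR⟩ : LieAlgebra.rootSpace H w) (by simpa using he0)).mp h1 ⟨x, hxR⟩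
    exact ⟨c, congrArg Subtype.val hc⟩
  have hnot : ¬ (IsLocallyNilpotentRoot H M α ∧ IsCuspidalRoot H M α) := by
    rintro ⟨hN, hC⟩
    obtain ⟨m, hm⟩ := exists_ne (0 : M)
    obtain ⟨n, hn⟩ := hN e he m
    have hinj : Function.Injective ((LieModule.toEnd ℂ L M e) ^ n) := by
      rw [Module.End.coe_pow]
      exact (hC e he he0).iterate n
    exact hm (hinj (by rw [hn, map_zero]))
  by_cases hb : nilSub M e hnil = ⊥
  · have hC : IsCuspidalRoot H M α := by
      intro x hx hx0
      obtain ⟨c, rfl⟩ := hspan x hx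
      have hc : c ≠ 0 := by rintro rfl; simp at hx0
      rw [injective_iff_map_eq_zero]
      intro m hm
      have hm' : ⁅e, m⁆ = 0 := by simpa [hc] using hm
      have : m ∈ nilSub M e hnil := (mem_nilSub M e hnil m).mpr ⟨1, by simpa using hm'⟩
      rw [hb] at this
      simpa using this
    exact Or.inr ⟨hC, fun h => hnot ⟨h, hC⟩⟩
  · have ht : nilSub M e hnil = ⊤ := (IsSimpleOrder.eq_bot_or_eq_top _).resolve_left hb
    have hN : IsLocallyNilpotentRoot H M α := by
      intro x hx m
      obtain ⟨c, rfl⟩ := hspan x hx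
      have : m ∈ nilSub M e hnil := by rw [ht]; trivial
      obtain ⟨n, hn⟩ := (mem_nilSub M e hnil m).mp this
      exact ⟨n, by rw [map_smul, smul_pow, LinearMap.smul_apply, hn, smul_zero]⟩
    exact Or.inl ⟨hN, fun h => hnot ⟨hN, h⟩⟩

end Paper
end

section
/- If M is a simple g-module such that M^{n⁺_θ} := {m ∈ M : n⁺_θ · m = 0} is nonzero, then M^{n⁺_θ} is a simple l_θ-module and M is isomorphic to L(θ, M^{n⁺_θ}), the unique simple quotient of the generalized Verma module V(θ, M^{n⁺_θ}). -/
namespace Paper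

open scoped Classical

open Module

variable {L : Type*} [LieRing L] [LieAlgebra ℂ L]

/-- `M^{n⁺_θ}`, the space of `n⁺_θ`-invariants of `M`. -/
def nInv (H : LieSubalgebra ℂ L) (Δ θ : Finset (Module.Dual ℂ H)) (M : Type*)
    [AddCommGroup M] [Module ℂ M] [LieRingModule L M] [LieModule ℂ L M] :
    Submodule ℂ M where
  carrier := {m | ∀ x ∈ nPlus H Δ θ, ⁅x, m⁆ = 0}
  add_mem' := by intro a b ha hb x hx; rw [lie_add, ha x hx, hb x hx, add_zero]
  zero_mem' := by intro x hx; rw [lie_zero]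
  smul_mem' := by intro c a ha x hx; rw [lie_smul, ha x hx, smul_zero]

/-- `W` is stable under the action of the Levi subalgebra `l_θ`. -/
def lStableAux (H : LieSubalgebra ℂ L) (θ : Finset (Module.Dual ℂ H)) {M : Type*}
    [AddCommGroup M] [Module ℂ M] [LieRingModule L M] [LieModule ℂ L M]
    (W : Submodule ℂ M) : Prop :=
  ∀ x ∈ levi H θ, ∀ m ∈ W, ⁅x, m⁆ ∈ W

/-- `(V, i)` is the generalized Verma module `U(g) ⊗_{U(p)} N` induced from the
`p`-module `N`, characterized by its universal property: `i : N → V` is a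
`p`-equivariant map, `V` is generated by the image of `i`, and every
`p`-equivariant map from `N` to a `g`-module extends uniquely to `V`. -/
def IsGVM (p : LieSubalgebra ℂ L)
    (N : Type*) [AddCommGroup N] [Module ℂ N] [LieRingModule p N] [LieModule ℂ p N]
    (V : Type*) [AddCommGroup V] [Module ℂ V] [LieRingModule L V] [LieModule ℂ L V]
    (i : N →ₗ[ℂ] V) : Prop :=
  (∀ (x : p) (n : N), i ⁅x, n⁆ = ⁅(x : L), i n⁆) ∧
  LieSubmodule.lieSpan ℂ L (Set.range i) = ⊤ ∧
  ∀ (W : Type*) [AddCommGroup W] [Module ℂ W] [LieRingModule L W] [LieModule ℂ L W]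
    (j : N →ₗ[ℂ] W), (∀ (x : p) (n : N), j ⁅x, n⁆ = ⁅(x : L), j n⁆) →
    ∃! φ : V →ₗ⁅ℂ,L⁆ W, ∀ n, φ (i n) = j n

set_option linter.unusedSectionVars false
section Growth

variable {L : Type*} [LieRing L] [LieAlgebra ℂ L] {d : ℕ} (b : Basis (Fin d) ℂ L)
  {M : Type*} [AddCommGroup M] [Module ℂ M] [LieRingModule L M] [LieModule ℂ L M]

/-- monomials -/
noncomputable def mon (m : M) (l : List (Fin d)) : M := l.foldr (fun i v => ⁅b i, v⁆) m

/-- the standard filtration -/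
noncomputable def fil (m : M) (n : ℕ) : Submodule ℂ M :=
  Submodule.span ℂ {v | ∃ l : List (Fin d), l.length ≤ n ∧ v = mon b m l}

lemma mon_mem_fil (m : M) (l : List (Fin d)) {n : ℕ} (h : l.length ≤ n) :
    mon b m l ∈ fil b m n := Submodule.subset_span ⟨l, h, rfl⟩

lemma fil_mono (m : M) {n k : ℕ} (h : n ≤ k) : fil b m n ≤ fil b m k := by
  apply Submodule.span_mono
  rintro v ⟨l, hl, rfl⟩
  exact ⟨l, hl.trans h, rfl⟩

lemma lie_mem_fil (m : M) {n : ℕ} (x : L) {v : M} (hv : v ∈ fil b m n) :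
    ⁅x, v⁆ ∈ fil b m (n + 1) := by
  induction hv using Submodule.span_induction with
  | mem v hv =>
    obtain ⟨l, hl, rfl⟩ := hv
    rw [← b.sum_repr x, sum_lie]
    refine Submodule.sum_mem _ fun i _ => ?_
    rw [smul_lie]
    exact Submodule.smul_mem _ _ (mon_mem_fil b m (i :: l) (by simpa using hl))
  | zero => simp
  | add u v _ _ hu hv => rw [lie_add]; exact Submodule.add_mem _ hu hv
  | smul c v _ hv => rw [lie_smul]; exact Submodule.smul_mem _ _ hv

lemma exists_mem_fil [LieModule.IsIrreducible ℂ L M] {m : M} (hm : m ≠ 0) (v : M) :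
    ∃ n, v ∈ fil b m n := by
  let P : LieSubmodule ℂ L M :=
    { carrier := {v | ∃ n, v ∈ fil b m n}
      add_mem' := by
        rintro u v ⟨n, hn⟩ ⟨k, hk⟩
        exact ⟨max n k, Submodule.add_mem _ (fil_mono b m (le_max_left _ _) hn)
          (fil_mono b m (le_max_right _ _) hk)⟩
      zero_mem' := ⟨0, Submodule.zero_mem _⟩
      smul_mem' := by
        rintro c v ⟨n, hn⟩
        exact ⟨n, Submodule.smul_mem _ _ hn⟩
      lie_mem := by
        rintro x v ⟨n, hn⟩
        exact ⟨n + 1, lie_mem_fil b m x hn⟩ }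
  have hP : P = ⊤ := by
    rcases IsSimpleOrder.eq_bot_or_eq_top P with h | h
    · exfalso
      have : m ∈ P := ⟨0, mon_mem_fil b m [] (by simp)⟩
      rw [h] at this
      exact hm (by simpa using this)
    · exact h
  have : v ∈ P := by rw [hP]; trivial
  exact this

lemma mon_perm (m : M) {l l' : List (Fin d)} (h : l.Perm l') :
    mon b m l - mon b m l' ∈ fil b m (l.length - 1) := by
  induction h with
  | nil => simp
  | @cons x l₁ l₂ h ih =>
    have : mon b m (x :: l₁) - mon b m (x :: l₂) = ⁅b x, mon b m l₁ - mon b m l₂⁆ := by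
      rw [lie_sub]; rfl
    rw [this]
    rcases Nat.eq_zero_or_pos l₁.length with h0 | h0
    · have e1 : l₁ = [] := List.length_eq_zero_iff.1 h0
      subst e1
      have e2 : l₂ = [] := by simpa using h
      subst e2
      simp
    · refine fil_mono b m ?_ (lie_mem_fil b m (b x) ih)
      simp; omega
  | swap x y l =>
    have : mon b m (y :: x :: l) - mon b m (x :: y :: l) = ⁅⁅b y, b x⁆, mon b m l⁆ := by
      rw [lie_lie]; rfl
    rw [this]
    refine fil_mono b m ?_ (lie_mem_fil b m _ (mon_mem_fil b m l le_rfl))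
    simp
  | @trans l₁ l₂ l₃ h1 h2 ih1 ih2 =>
    have := Submodule.add_mem _ ih1 (h1.length_eq ▸ ih2)
    simpa using this

/-- functions encode multisets -/
noncomputable def ordl {n : ℕ} (f : Fin d → Fin n) : List (Fin d) :=
  (∑ i, Multiset.replicate (f i : ℕ) i).toList

lemma fil_le_span (m : M) (n k : ℕ) (hk : k ≤ n) :
    fil b m k ≤ Submodule.span ℂ (Set.range fun f : Fin d → Fin (n + 1) => mon b m (ordl f)) := by
  induction k with
  | zero =>
    refine Submodule.span_le.2 ?_
    rintro v ⟨l, hl, rfl⟩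
    have : l = [] := by simpa using hl
    subst this
    apply Submodule.subset_span
    exact ⟨fun _ => 0, by simp [ordl]⟩
  | succ k ih =>
    specialize ih (by omega)
    refine Submodule.span_le.2 ?_
    rintro v ⟨l, hl, rfl⟩
    let f : Fin d → Fin (n + 1) := fun i => ⟨l.count i, by
      have := List.count_le_length (l := l) (a := i); omega⟩
    have hp : l.Perm (ordl f) := by
      rw [← Multiset.coe_eq_coe, ordl, Multiset.coe_toList]
      ext i
      rw [Multiset.count_sum']
      simp [f, Multiset.count_replicate]
    have h1 := mon_perm b m hp
    have h2 : mon b m l = (mon b m l - mon b m (ordl f)) + mon b m (ordl f) := by simp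
    rw [h2]
    refine Submodule.add_mem _ (ih (fil_mono b m (by omega) h1)) (Submodule.subset_span ⟨f, rfl⟩)

instance fil_finite (m : M) (n : ℕ) : FiniteDimensional ℂ (fil b m n) := by
  have : FiniteDimensional ℂ
    (Submodule.span ℂ (Set.range fun f : Fin d → Fin (n + 1) => mon b m (ordl f))) :=
    FiniteDimensional.span_of_finite ℂ (Set.finite_range _)
  exact Submodule.finiteDimensional_of_le (fil_le_span b m n n le_rfl)

lemma finrank_fil_le (m : M) (n : ℕ) : finrank ℂ (fil b m n) ≤ (n + 1) ^ d := by
  have : FiniteDimensional ℂ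
    (Submodule.span ℂ (Set.range fun f : Fin d → Fin (n + 1) => mon b m (ordl f))) :=
    FiniteDimensional.span_of_finite ℂ (Set.finite_range _)
  refine (Submodule.finrank_mono (fil_le_span b m n n le_rfl)).trans ?_
  refine (finrank_range_le_card _).trans ?_
  simp

lemma span_mon [LieModule.IsIrreducible ℂ L M] {m : M} (hm : m ≠ 0) :
    Submodule.span ℂ (Set.range (mon b m)) = ⊤ := by
  rw [eq_top_iff]
  intro v _
  obtain ⟨n, hn⟩ := exists_mem_fil b hm v
  refine Submodule.span_mono ?_ hn
  rintro _ ⟨l, _, rfl⟩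
  exact ⟨l, rfl⟩

end Growth

section Dixmier

universe w

variable {L : Type*} [LieRing L] [LieAlgebra ℂ L] [FiniteDimensional ℂ L]
  {M : Type*} [AddCommGroup M] [Module ℂ M] [LieRingModule L M] [LieModule ℂ L M]
  [LieModule.IsIrreducible ℂ L M]


lemma irr_bij (T : M →ₗ⁅ℂ,L⁆ M) (hT : T ≠ 0) : Function.Bijective T := by
  constructor
  · rw [← LieModuleHom.ker_eq_bot]
    rcases IsSimpleOrder.eq_bot_or_eq_top T.ker with h | h
    · exact h
    · exfalso
      apply hT
      ext v
      have : v ∈ T.ker := by rw [h]; trivial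
      simpa using this
  · rw [← LieModuleHom.range_eq_top]
    rcases IsSimpleOrder.eq_bot_or_eq_top T.range with h | h
    · exfalso
      apply hT
      ext v
      have : T v ∈ T.range := ⟨v, rfl⟩
      rw [h] at this
      simpa using this
    · exact h

lemma small_irr (L : Type*) [LieRing L] [LieAlgebra ℂ L] [FiniteDimensional ℂ L]
  (M : Type*) [AddCommGroup M] [Module ℂ M] [LieRingModule L M] [LieModule ℂ L M]
  [LieModule.IsIrreducible ℂ L M] : Small.{w} M := by
  have := (LieSubmodule.nontrivial_iff ℂ L M).1 inferInstance
  obtain ⟨m, hm⟩ := exists_ne (0 : M)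
  have hs := span_mon (finBasis ℂ L) hm
  have : Function.Surjective (Finsupp.linearCombination ℂ (mon (finBasis ℂ L) m)) := by
    rw [← LinearMap.range_eq_top, Finsupp.range_linearCombination, hs]
  have h0 : Small.{0} M := small_of_surjective this
  exact small_lift.{_, w, 0} M

lemma rank_irr (L : Type*) [LieRing L] [LieAlgebra ℂ L] [FiniteDimensional ℂ L]
  (M : Type*) [AddCommGroup M] [Module ℂ M] [LieRingModule L M] [LieModule ℂ L M]
  [LieModule.IsIrreducible ℂ L M] : Module.rank ℂ M ≤ Cardinal.aleph0 := by
  have := (LieSubmodule.nontrivial_iff ℂ L M).1 inferInstance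
  obtain ⟨m, hm⟩ := exists_ne (0 : M)
  have hs := span_mon (finBasis ℂ L) hm
  rw [← rank_top, ← hs]
  refine (rank_span_le _).trans ?_
  exact Cardinal.le_aleph0_iff_set_countable.2 (Set.countable_range _)

lemma schur (T : M →ₗ⁅ℂ,L⁆ M) : ∃ c : ℂ, ∀ v, T v = c • v := by
  by_contra! hc
  have := (LieSubmodule.nontrivial_iff ℂ L M).1 inferInstance
  obtain ⟨m, hm⟩ := exists_ne (0 : M)
  have hb : ∀ c : ℂ, Function.Bijective (T - c • (LieModuleHom.id : M →ₗ⁅ℂ,L⁆ M)) := by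
    intro c
    apply irr_bij
    intro h
    obtain ⟨v, hv⟩ := hc c
    apply hv
    have := congrArg (fun f => f v) h
    simpa [sub_eq_zero] using this
  choose v hv using fun c => (hb c).2 m
  let S : Module.End ℂ M := T
  have hS : ∀ (c : ℂ) (u : M), (T - c • (LieModuleHom.id : M →ₗ⁅ℂ,L⁆ M)) u = (Polynomial.aeval S (Polynomial.X - Polynomial.C c : Polynomial ℂ)) u := by
    intro c u
    simp [S, Module.algebraMap_end_apply]
  have hinj : ∀ q : Polynomial ℂ, q ≠ 0 → Function.Injective (Polynomial.aeval S q) := by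
    intro q hq
    have hsp := IsAlgClosed.splits q
    rw [hsp.eq_prod_roots]
    have : ∀ s : Multiset ℂ, Function.Injective
        (Polynomial.aeval S ((s.map fun a => Polynomial.X - Polynomial.C a).prod : Polynomial ℂ)) := by
      intro s
      induction s using Multiset.induction_on with
      | empty => simp; exact Function.injective_id
      | cons a s ih =>
        rw [Multiset.map_cons, Multiset.prod_cons, map_mul, Module.End.mul_eq_comp, LinearMap.coe_comp]
        refine Function.Injective.comp ?_ ih
        have := (hb a).1
        intro x y hxy
        apply this
        rw [hS, hS]; exact hxy
    rw [map_mul, Module.End.mul_eq_comp, LinearMap.coe_comp]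
    refine Function.Injective.comp ?_ (this _)
    intro x y hxy
    simp [Module.algebraMap_end_apply] at hxy
    exact smul_right_injective M (Polynomial.leadingCoeff_ne_zero.2 hq) hxy
  have hli : LinearIndependent ℂ v := by
    rw [linearIndependent_iff']
    intro s g hg i hi
    let q : Polynomial ℂ := ∑ c ∈ s, Polynomial.C (g c) * ∏ c' ∈ s.erase c, (Polynomial.X - Polynomial.C c')
    have hq0 : Polynomial.aeval S q m = 0 := by
      have : Polynomial.aeval S (∏ c ∈ s, (Polynomial.X - Polynomial.C c) : Polynomial ℂ) (∑ c ∈ s, g c • v c) = Polynomial.aeval S q m := by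
        rw [map_sum]
        simp only [q, map_sum, LinearMap.sum_apply]
        refine Finset.sum_congr rfl fun c hcs => ?_
        rw [← Finset.prod_erase_mul _ _ hcs, map_mul, Module.End.mul_apply, map_smul, ← hS, map_smul, hv]
        simp [Module.algebraMap_end_apply]
      rw [← this, hg, map_zero]
    have hq : q = 0 := by
      by_contra hne
      exact hm (hinj q hne (by rw [hq0, map_zero]))
    have he := congrArg (Polynomial.eval i) hq
    simp only [q, Polynomial.eval_finsetSum, Polynomial.eval_mul, Polynomial.eval_C, Polynomial.eval_prod, Polynomial.eval_sub, Polynomial.eval_X, Polynomial.eval_zero] at he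
    rw [Finset.sum_eq_single i] at he
    · rcases mul_eq_zero.1 he with h | h
      · exact h
      · exfalso
        obtain ⟨a, ha, h⟩ := Finset.prod_eq_zero_iff.1 h
        exact (Finset.mem_erase.1 ha).1 (sub_eq_zero.1 h).symm
    · intro c hcs hci
      rw [Finset.prod_eq_zero (i := i), mul_zero]
      · exact Finset.mem_erase.2 ⟨hci.symm, hi⟩
      · simp
    · intro h; exact absurd hi h
  have h1 := hli.cardinal_lift_le_rank
  have h2 : Cardinal.lift.{0} (Module.rank ℂ M) ≤ Cardinal.aleph0 := by
    simpa using rank_irr L M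
  have h3 := h1.trans h2
  rw [Cardinal.lift_le_aleph0, Cardinal.mk_complex] at h3
  exact absurd h3 (not_le.2 Cardinal.aleph0_lt_continuum)

end Dixmier

section FiniteHom

variable {L : Type*} [LieRing L] [LieAlgebra ℂ L] [FiniteDimensional ℂ L]
  {M : Type*} [AddCommGroup M] [Module ℂ M] [LieRingModule L M] [LieModule ℂ L M]
  [LieModule.IsIrreducible ℂ L M]

lemma hom_indep {Y : Type*} [AddCommGroup Y] [Module ℂ Y] [LieRingModule L Y] [LieModule ℂ L Y]
    (n : ℕ) (ψ : Fin n → (M →ₗ⁅ℂ,L⁆ Y)) (h : LinearIndependent ℂ ψ) (m : Fin n → M)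
    (hm : ∑ k, ψ k (m k) = 0) : m = 0 := by
  induction n with
  | zero => exact Subsingleton.elim _ _
  | succ n ih =>
    have h' : LinearIndependent ℂ (fun k : Fin n => ψ k.castSucc) :=
      h.comp _ (Fin.castSucc_injective n)
    have ih := ih _ h'
    have key : m (Fin.last n) = 0 := by
      let K : LieSubmodule ℂ L M :=
        { carrier := {v | ∃ u : Fin n → M, ψ (Fin.last n) v = ∑ k, ψ k.castSucc (u k)}
          add_mem' := by
            rintro v v' ⟨u, hu⟩ ⟨u', hu'⟩
            exact ⟨u + u', by simp [hu, hu', Finset.sum_add_distrib]⟩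
          zero_mem' := ⟨0, by simp⟩
          smul_mem' := by
            rintro c v ⟨u, hu⟩
            exact ⟨c • u, by simp [hu, Finset.smul_sum]⟩
          lie_mem := by
            rintro x v ⟨u, hu⟩
            exact ⟨fun k => ⁅x, u k⁆, by simp [hu, lie_sum]⟩ }
      rcases IsSimpleOrder.eq_bot_or_eq_top K with hK | hK
      · have : m (Fin.last n) ∈ K := by
          refine ⟨fun k => - m k.castSucc, ?_⟩
          rw [Fin.sum_univ_castSucc] at hm
          simp only [map_neg, Finset.sum_neg_distrib]
          exact eq_neg_of_add_eq_zero_right hm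
        rw [hK] at this
        simpa using this
      · exfalso
        have hall : ∀ v, ∃ u : Fin n → M, ψ (Fin.last n) v = ∑ k, ψ k.castSucc (u k) := by
          intro v
          have : v ∈ K := by rw [hK]; trivial
          exact this
        choose u hu using hall
        have huniq : ∀ v (u' : Fin n → M), ψ (Fin.last n) v = ∑ k, ψ k.castSucc (u' k) →
            u' = u v := by
          intro v u' h1
          have := ih (u' - u v) (by simp [Finset.sum_sub_distrib, ← h1, ← hu])
          exact sub_eq_zero.1 this
        let T : Fin n → (M →ₗ⁅ℂ,L⁆ M) := fun k =>
          { toFun := fun v => u v k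
            map_add' := by
              intro v v'
              have := huniq (v + v') (u v + u v') (by rw [map_add, hu v, hu v']; simp [Finset.sum_add_distrib])
              rw [← this]; rfl
            map_smul' := by
              intro c v
              have := huniq (c • v) (c • u v) (by rw [map_smul, hu v]; simp [Finset.smul_sum])
              rw [← this]; rfl
            map_lie' := by
              intro x v
              have := huniq ⁅x, v⁆ (fun k => ⁅x, u v k⁆) (by rw [LieModuleHom.map_lie, hu v]; simp [lie_sum])
              rw [← this] }
        choose c hc using fun k => schur (T k)
        have hrel : ψ (Fin.last n) = ∑ k : Fin n, c k • ψ k.castSucc := by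
          ext v
          rw [hu]
          have : ∀ k, u v k = c k • v := fun k => hc k v
          have e : ∀ s : Finset (Fin n), (∑ k ∈ s, c k • ψ k.castSucc) v =
              ∑ k ∈ s, c k • ψ k.castSucc v := by
            intro s
            induction s using Finset.induction_on with
            | empty => simp
            | insert a s ha ih => rw [Finset.sum_insert ha, Finset.sum_insert ha, ← ih]; simp
          rw [e]
          simp [this]
        have hnot := linearIndependent_finSucc'.1 h
        apply hnot.2
        rw [hrel]
        refine Submodule.sum_mem _ fun k _ => Submodule.smul_mem _ _ (Submodule.subset_span ⟨k, rfl⟩)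
    rw [Fin.sum_univ_castSucc, key, map_zero, add_zero] at hm
    have := ih _ hm
    ext k
    refine Fin.lastCases key (fun k => ?_) k
    exact congrFun this k

lemma growth_arith (a : ℕ → ℕ) (c d : ℕ) (h0 : 0 < a 0) (h1 : ∀ k, 2 * a k ≤ a (k + c))
    (h2 : ∀ k, a k ≤ (k + 1) ^ d) : False := by
  have h3 : ∀ j, 2 ^ j ≤ a (j * c) := by
    intro j
    induction j with
    | zero => simpa using Nat.succ_le_of_lt h0
    | succ j ih =>
      have := h1 (j * c)
      rw [Nat.succ_mul, pow_succ]
      omega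
  have h4 := tendsto_pow_const_div_const_pow_of_one_lt d (r := (2 : ℝ)) (by norm_num)
  have h5 := (h4.eventually (gt_mem_nhds (show (0 : ℝ) < 1 / (c + 1) ^ d by positivity))).and
    (Filter.eventually_ge_atTop 1)
  obtain ⟨j, hj, hj1⟩ := h5.exists
  rw [div_lt_div_iff₀ (by positivity) (by positivity), one_mul, ← mul_pow] at hj
  have h6 : ((2 ^ j : ℕ) : ℝ) ≤ (((j * c + 1) ^ d : ℕ) : ℝ) := by
    exact_mod_cast (h3 j).trans (h2 _)
  have h7 : (((j * c + 1) ^ d : ℕ) : ℝ) ≤ ((j : ℝ) * (c + 1)) ^ d := by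
    push_cast
    have : (1 : ℝ) ≤ j := by exact_mod_cast hj1
    gcongr
    linarith
  push_cast at h6 h7
  linarith

variable {F : Type*} [AddCommGroup F] [Module ℂ F] [LieRingModule L F] [LieModule ℂ L F]
  [FiniteDimensional ℂ F]

/-- maps into the filtration -/
noncomputable def filY {d : ℕ} (b : Basis (Fin d) ℂ L) (F : Type*) [AddCommGroup F] [Module ℂ F]
    (m : M) (n : ℕ) : Submodule ℂ (F →ₗ[ℂ] M) where
  carrier := {f | ∀ u, f u ∈ fil b m n}
  add_mem' := by intro f g hf hg u; exact Submodule.add_mem _ (hf u) (hg u)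
  zero_mem' := by intro u; exact Submodule.zero_mem _
  smul_mem' := by intro c f hf u; exact Submodule.smul_mem _ _ (hf u)

lemma filY_inj {d : ℕ} (b : Basis (Fin d) ℂ L) (m : M) (n : ℕ) :
    ∃ g : filY b F m n →ₗ[ℂ] (F →ₗ[ℂ] fil b m n), Function.Injective g := by
  refine ⟨{ toFun := fun f => f.1.codRestrict _ f.2, map_add' := ?_, map_smul' := ?_ }, ?_⟩
  · intro f g; rfl
  · intro c f; rfl
  · intro f g h
    ext u
    have := congrArg (fun k => ((k u : fil b m n) : M)) h
    exact this

instance {d : ℕ} (b : Basis (Fin d) ℂ L) (m : M) (n : ℕ) :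
    FiniteDimensional ℂ (filY b F m n) := by
  obtain ⟨g, hg⟩ := filY_inj (F := F) b m n
  exact FiniteDimensional.of_injective g hg

lemma finrank_filY {d : ℕ} (b : Basis (Fin d) ℂ L) (m : M) (n : ℕ) :
    finrank ℂ (filY b F m n) ≤ finrank ℂ F * finrank ℂ (fil b m n) := by
  obtain ⟨g, hg⟩ := filY_inj (F := F) b m n
  refine (LinearMap.finrank_le_finrank_of_injective hg).trans ?_
  rw [Module.finrank_linearMap]

lemma hom_dep (n : ℕ) (hn : 2 * finrank ℂ F < n) (ψ : Fin n → (M →ₗ⁅ℂ,L⁆ (F →ₗ[ℂ] M))) :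
    ¬ LinearIndependent ℂ ψ := by
  intro h
  have := (LieSubmodule.nontrivial_iff ℂ L M).1 inferInstance
  obtain ⟨m, hm⟩ := exists_ne (0 : M)
  let b := finBasis ℂ L
  let bF := finBasis ℂ F
  choose c₀ hc₀ using fun (j : Fin n) (i : Fin (finrank ℂ F)) =>
    exists_mem_fil b hm (ψ j m (bF i))
  let c : ℕ := ∑ j, ∑ i, c₀ j i
  have hc : ∀ j, ψ j m ∈ filY b F m c := by
    intro j u
    rw [← bF.sum_repr u, map_sum]
    refine Submodule.sum_mem _ fun i _ => ?_
    rw [map_smul]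
    refine Submodule.smul_mem _ _ (fil_mono b m ?_ (hc₀ j i))
    calc c₀ j i ≤ ∑ i, c₀ j i := Finset.single_le_sum (f := fun i => c₀ j i) (by simp) (Finset.mem_univ i)
      _ ≤ c := Finset.single_le_sum (f := fun j => ∑ i, c₀ j i) (by simp) (Finset.mem_univ j)
  have hlie : ∀ (x : L) k (f : F →ₗ[ℂ] M), f ∈ filY b F m k → ⁅x, f⁆ ∈ filY b F m (k + 1) := by
    intro x k f hf u
    rw [LieHom.lie_apply]
    exact Submodule.sub_mem _ (lie_mem_fil b m x (hf u)) (fil_mono b m (by omega) (hf _))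
  have hmon : ∀ j (l : List _), ψ j (mon b m l) ∈ filY b F m (l.length + c) := by
    intro j l
    induction l with
    | nil => simpa [mon] using hc j
    | cons i l ih =>
      have : ψ j (mon b m (i :: l)) = ⁅b i, ψ j (mon b m l)⁆ := by
        rw [← LieModuleHom.map_lie]; rfl
      rw [this, List.length_cons, add_right_comm]
      exact hlie _ _ _ ih
  have hYmono : ∀ {k k' : ℕ}, k ≤ k' → filY b F m k ≤ filY b F m k' :=
    fun hk f hf u => fil_mono b m hk (hf u)
  have hfil : ∀ j k v, v ∈ fil b m k → ψ j v ∈ filY b F m (k + c) := by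
    intro j k v hv
    induction hv using Submodule.span_induction with
    | mem v hv =>
      obtain ⟨l, hl, rfl⟩ := hv
      exact hYmono (by omega) (hmon j l)
    | zero => simp
    | add u v _ _ hu hv => rw [map_add]; exact Submodule.add_mem _ hu hv
    | smul a v _ hv => rw [map_smul]; exact Submodule.smul_mem _ _ hv
  have hdim : ∀ k, n * finrank ℂ (fil b m k) ≤ finrank ℂ F * finrank ℂ (fil b m (k + c)) := by
    intro k
    let Φ : (Fin n → fil b m k) →ₗ[ℂ] filY b F m (k + c) :=
      { toFun := fun v => ⟨∑ j, ψ j (v j), Submodule.sum_mem _ fun j _ => hfil j k _ (v j).2⟩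
        map_add' := by
          intro u v
          ext1
          simp [Finset.sum_add_distrib]
        map_smul' := by
          intro a v
          ext1
          simp [Finset.smul_sum] }
    have hΦ : Function.Injective Φ := by
      rw [← LinearMap.ker_eq_bot, LinearMap.ker_eq_bot']
      intro v hv
      have h1 := hom_indep n ψ h (fun j => (v j : M)) (congrArg Subtype.val hv)
      ext j
      exact congrFun h1 j
    have := (LinearMap.finrank_le_finrank_of_injective hΦ).trans (finrank_filY b m (k + c))
    rw [Module.finrank_pi_fintype] at this
    simpa using this
  refine growth_arith (fun k => finrank ℂ (fil b m k)) c _ ?_ ?_ (finrank_fil_le b m)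
  · have : Nontrivial (fil b m 0) := by
      refine ⟨⟨⟨m, mon_mem_fil b m [] (by simp)⟩, 0, ?_⟩⟩
      intro h; exact hm (congrArg Subtype.val h)
    exact finrank_pos
  · intro k
    have h1 := hdim k
    have h2 : (2 * finrank ℂ F) * finrank ℂ (fil b m k) ≤ n * finrank ℂ (fil b m k) :=
      Nat.mul_le_mul_right _ hn.le
    rcases Nat.eq_zero_or_pos (finrank ℂ F) with h0 | h0
    · rw [h0, zero_mul] at h1
      have : finrank ℂ (fil b m k) = 0 := by
        rcases Nat.mul_eq_zero.1 (Nat.le_zero.1 h1) with h | h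
        · omega
        · exact h
      show 2 * finrank ℂ (fil b m k) ≤ finrank ℂ (fil b m (k + c))
      omega
    · show 2 * finrank ℂ (fil b m k) ≤ finrank ℂ (fil b m (k + c))
      refine Nat.le_of_mul_le_mul_left ?_ h0
      nlinarith

end FiniteHom

section Casimir

variable {L : Type*} [LieRing L] [LieAlgebra ℂ L] [FiniteDimensional ℂ L]
  [LieAlgebra.IsKilling ℂ L]

/-- dual basis for the Killing form -/
noncomputable def kdual : Basis (Fin (finrank ℂ L)) ℂ L :=
  LinearMap.BilinForm.dualBasis (killingForm ℂ L) (LieAlgebra.IsKilling.killingForm_nondegenerate ℂ L)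
    (finBasis ℂ L)

lemma killing_inv (x y z : L) : killingForm ℂ L y ⁅x, z⁆ = - killingForm ℂ L ⁅x, y⁆ z := by
  have h := LieModule.traceForm_apply_lie_apply' ℂ L L x y z
  rw [killingForm, h, neg_neg]

lemma killing_comm (x y : L) : killingForm ℂ L x y = killingForm ℂ L y x :=
  LieModule.traceForm_comm ℂ L L x y

lemma kdual_apply (i j : Fin (finrank ℂ L)) :
    killingForm ℂ L (kdual i) (finBasis ℂ L j) = if j = i then 1 else 0 := by
  rw [kdual, LinearMap.BilinForm.apply_dualBasis_left]

lemma expand_b (y : L) : y = ∑ j, killingForm ℂ L (kdual j) y • finBasis ℂ L j := by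
  conv_lhs => rw [← (finBasis ℂ L).sum_repr y]
  refine Finset.sum_congr rfl fun j _ => ?_
  congr 1
  conv_rhs => rw [← (finBasis ℂ L).sum_repr y]
  simp only [map_sum, map_smul, kdual_apply]
  simp

lemma expand_d (y : L) : y = ∑ j, killingForm ℂ L (finBasis ℂ L j) y • kdual j := by
  conv_lhs => rw [← (kdual (L := L)).sum_repr y]
  refine Finset.sum_congr rfl fun j _ => ?_
  congr 1
  conv_rhs => rw [← (kdual (L := L)).sum_repr y]
  rw [killing_comm, map_sum, LinearMap.sum_apply]
  simp only [map_smul, LinearMap.smul_apply, kdual_apply]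
  simp

variable {M : Type*} [AddCommGroup M] [Module ℂ M] [LieRingModule L M] [LieModule ℂ L M]

lemma casimir_inv (B : L →ₗ[ℂ] L →ₗ[ℂ] M) (x : L) :
    ∑ i, B ⁅x, finBasis ℂ L i⁆ (kdual i) + ∑ i, B (finBasis ℂ L i) ⁅x, kdual i⁆ = 0 := by
  have h1 : ∀ i, B ⁅x, finBasis ℂ L i⁆ (kdual i) = ∑ j,
      killingForm ℂ L (kdual j) ⁅x, finBasis ℂ L i⁆ • B (finBasis ℂ L j) (kdual i) := by
    intro i
    conv_lhs => rw [expand_b ⁅x, finBasis ℂ L i⁆]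
    simp [map_sum, LinearMap.sum_apply]
  have h2 : ∀ i, B (finBasis ℂ L i) ⁅x, kdual i⁆ = ∑ j,
      killingForm ℂ L (finBasis ℂ L j) ⁅x, kdual i⁆ • B (finBasis ℂ L i) (kdual j) := by
    intro i
    conv_lhs => rw [expand_d ⁅x, kdual i⁆]
    simp [map_sum]
  simp_rw [h1, h2]
  rw [Finset.sum_comm, ← Finset.sum_add_distrib]
  refine Finset.sum_eq_zero fun i _ => ?_
  rw [← Finset.sum_add_distrib]
  refine Finset.sum_eq_zero fun j _ => ?_
  rw [← add_smul, killing_inv x (finBasis ℂ L j), killing_comm (kdual i), add_neg_cancel, zero_smul]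

variable (E : Type*) [AddCommGroup E] [Module ℂ E] [LieRingModule L E] [LieModule ℂ L E]

/-- one step -/
noncomputable def thetaFun (f : (E →ₗ[ℂ] E) →ₗ[ℂ] M) : (E →ₗ[ℂ] E) →ₗ[ℂ] M where
  toFun u := ∑ i, ⁅finBasis ℂ L i, f (u ∘ₗ LieModule.toEnd ℂ L E (kdual i))⁆
  map_add' u v := by simp [LinearMap.add_comp, Finset.sum_add_distrib]
  map_smul' c u := by simp [LinearMap.smul_comp, Finset.smul_sum]

/-- the equivariant step -/
noncomputable def theta : ((E →ₗ[ℂ] E) →ₗ[ℂ] M) →ₗ⁅ℂ,L⁆ ((E →ₗ[ℂ] E) →ₗ[ℂ] M) where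
  toFun f := thetaFun (L := L) E f
  map_add' f g := by ext u; simp [thetaFun, Finset.sum_add_distrib]
  map_smul' c u := by ext u; simp [thetaFun, Finset.smul_sum]
  map_lie' := by
    intro x f
    ext u
    have hB := casimir_inv (M := M)
      (LinearMap.mk₂ ℂ (fun y y' : L => ⁅y, f (u ∘ₗ LieModule.toEnd ℂ L E y')⁆)
        (by intros; simp) (by intros; simp)
        (by intros; simp [LinearMap.comp_add]) (by intros; simp [LinearMap.comp_smul])) x
    simp only [LinearMap.mk₂_apply] at hB
    have hu : ∀ i : Fin (finrank ℂ L), ⁅x, u ∘ₗ LieModule.toEnd ℂ L E (kdual i)⁆ =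
        ⁅x, u⁆ ∘ₗ LieModule.toEnd ℂ L E (kdual i) + u ∘ₗ LieModule.toEnd ℂ L E ⁅x, kdual i⁆ := by
      intro i
      ext v
      simp [LieHom.lie_apply]
    show ∑ i, ⁅finBasis ℂ L i, ⁅x, f⁆ (u ∘ₗ LieModule.toEnd ℂ L E (kdual i))⁆ =
      ⁅x, ∑ i, ⁅finBasis ℂ L i, f (u ∘ₗ LieModule.toEnd ℂ L E (kdual i))⁆⁆ -
      ∑ i, ⁅finBasis ℂ L i, f (⁅x, u⁆ ∘ₗ LieModule.toEnd ℂ L E (kdual i))⁆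
    rw [lie_sum, ← Finset.sum_sub_distrib, ← add_zero (∑ i, _), ← hB, ← Finset.sum_add_distrib,
      ← Finset.sum_add_distrib]
    refine Finset.sum_congr rfl fun i _ => ?_
    rw [LieHom.lie_apply, hu, map_add, lie_sub, lie_add, leibniz_lie x]
    abel

variable (L M) in
/-- the base -/
noncomputable def psi0 : M →ₗ⁅ℂ,L⁆ ((E →ₗ[ℂ] E) →ₗ[ℂ] M) where
  toFun m := (LinearMap.trace ℂ E).smulRight m
  map_add' := by intros; ext; simp
  map_smul' := by intro c m; ext u; exact smul_comm _ _ _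
  map_lie' := by
    intro x m
    ext u
    have : LinearMap.trace ℂ E ⁅x, u⁆ = 0 := by
      have h : ⁅x, u⁆ = LieModule.toEnd ℂ L E x * u - u * LieModule.toEnd ℂ L E x := by
        ext v; simp [LieHom.lie_apply]
      rw [h, map_sub, LinearMap.trace_mul_comm, sub_self]
    simp [LieHom.lie_apply, this]

variable (L M) in
/-- the powers -/
noncomputable def psi : ℕ → (M →ₗ⁅ℂ,L⁆ ((E →ₗ[ℂ] E) →ₗ[ℂ] M))
  | 0 => psi0 L M E
  | k + 1 => (theta E).comp (psi k)

lemma psi_apply [FiniteDimensional ℂ E] (e : E) (z : L) (W : Submodule ℂ M)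
    (hzW : ∀ w ∈ W, ⁅z, w⁆ ∈ W)
    (hkey : ∀ (y : L) (ξ : Module.Dual ℂ E), (∀ x, killingForm ℂ L y x = ξ ⁅x, e⁆) →
      ∀ w ∈ W, ⁅y, w⁆ = ξ e • ⁅z, w⁆) (k : ℕ) (ξ : Module.Dual ℂ E) (w : M) (hw : w ∈ W) :
    psi L M E k w (ξ.smulRight e) = ξ e • ((LieModule.toEnd ℂ L M z) ^ k) w ∧
      ((LieModule.toEnd ℂ L M z) ^ k) w ∈ W := by
  induction k generalizing ξ with
  | zero =>
    refine ⟨?_, by simpa using hw⟩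
    show LinearMap.trace ℂ E (ξ.smulRight e) • w = _
    rw [LinearMap.trace_smulRight]
    simp
  | succ k ih =>
    have ih2 := (ih ξ).2
    refine ⟨?_, ?_⟩
    · show ∑ i, ⁅finBasis ℂ L i, psi L M E k w (ξ.smulRight e ∘ₗ LieModule.toEnd ℂ L E (kdual i))⁆ = _
      have h1 : ∀ i : Fin (finrank ℂ L), ξ.smulRight e ∘ₗ LieModule.toEnd ℂ L E (kdual i) =
          (ξ ∘ₗ LieModule.toEnd ℂ L E (kdual i)).smulRight e := by
        intro i; ext v; simp
      have h2 : ∀ i : Fin (finrank ℂ L), ⁅finBasis ℂ L i, psi L M E k w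
          (ξ.smulRight e ∘ₗ LieModule.toEnd ℂ L E (kdual i))⁆ =
          ⁅ξ ⁅kdual i, e⁆ • finBasis ℂ L i, ((LieModule.toEnd ℂ L M z) ^ k) w⁆ := by
        intro i
        rw [h1, (ih _).1]
        simp
      simp_rw [h2]
      rw [← sum_lie, hkey _ ξ _ _ ih2]
      · rw [pow_succ']; rfl
      · intro x
        conv_rhs => rw [expand_d x]
        rw [map_sum, LinearMap.sum_apply, sum_lie, map_sum]
        refine Finset.sum_congr rfl fun i _ => ?_
        simp [mul_comm]
    · rw [pow_succ']
      exact hzW _ ih2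

lemma exists_eigen_aux {M : Type*} [AddCommGroup M] [Module ℂ M] (S : Module.End ℂ M)
    (W : Submodule ℂ M) (hzW : ∀ w ∈ W, S w ∈ W) (s : Multiset ℂ) (w : M) (hw : w ∈ W)
    (hw0 : w ≠ 0)
    (hqw : Polynomial.aeval S (Multiset.map (fun x => Polynomial.X - Polynomial.C x) s).prod w = 0) :
    ∃ c : ℂ, ∃ w ∈ W, w ≠ 0 ∧ S w = c • w := by
  induction s using Multiset.induction_on generalizing w with
  | empty => exact absurd (by simpa using hqw) hw0
  | cons a s ih =>
    rw [Multiset.map_cons, Multiset.prod_cons, mul_comm, map_mul, Module.End.mul_apply] at hqw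
    by_cases h : Polynomial.aeval S (Polynomial.X - Polynomial.C a : Polynomial ℂ) w = 0
    · refine ⟨a, w, hw, hw0, ?_⟩
      simpa [sub_eq_zero, Module.algebraMap_end_apply] using h
    · refine ih _ ?_ h hqw
      simp only [map_sub, Polynomial.aeval_X, Polynomial.aeval_C, LinearMap.sub_apply,
        Module.algebraMap_end_apply]
      exact Submodule.sub_mem _ (hzW w hw) (Submodule.smul_mem _ _ hw)

lemma exists_eigen [LieModule.IsIrreducible ℂ L M] [FiniteDimensional ℂ E] (e : E) (he : e ≠ 0)
    (z : L) (W : Submodule ℂ M) (hW : W ≠ ⊥)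
    (hzW : ∀ w ∈ W, ⁅z, w⁆ ∈ W)
    (hkey : ∀ (y : L) (ξ : Module.Dual ℂ E), (∀ x, killingForm ℂ L y x = ξ ⁅x, e⁆) →
      ∀ w ∈ W, ⁅y, w⁆ = ξ e • ⁅z, w⁆) :
    ∃ c : ℂ, ∃ w ∈ W, w ≠ 0 ∧ ⁅z, w⁆ = c • w := by
  obtain ⟨w, hw, hw0⟩ := Submodule.exists_mem_ne_zero_of_ne_bot hW
  obtain ⟨ξ, hξ⟩ : ∃ ξ : Module.Dual ℂ E, ξ e = 1 := Module.Projective.exists_dual_eq_one ℂ he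
  let n := 2 * finrank ℂ (E →ₗ[ℂ] E) + 1
  have hdep := hom_dep (L := L) (M := M) (F := E →ₗ[ℂ] E) n (by omega) (fun k => psi L M E k)
  rw [Fintype.not_linearIndependent_iff] at hdep
  obtain ⟨g, hg, k₀, hk₀⟩ := hdep
  let S := LieModule.toEnd ℂ L M z
  have hrel : ∑ k : Fin n, g k • (S ^ (k : ℕ)) w = 0 := by
    have e : ∀ s : Finset (Fin n), (∑ k ∈ s, g k • psi L M E k) w (ξ.smulRight e) =
        ∑ k ∈ s, g k • (S ^ (k : ℕ)) w := by
      intro s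
      induction s using Finset.induction_on with
      | empty => simp
      | insert a s ha ih =>
        rw [Finset.sum_insert ha, Finset.sum_insert ha, ← ih]
        simp [(psi_apply E e z W hzW hkey a ξ w hw).1, hξ, S]
    rw [← e, hg]; simp
  let q : Polynomial ℂ := ∑ k : Fin n, Polynomial.C (g k) * Polynomial.X ^ (k : ℕ)
  have hq : q ≠ 0 := by
    intro h
    apply hk₀
    have := congrArg (fun p => Polynomial.coeff p (k₀ : ℕ)) h
    simp only [q, Polynomial.finsetSum_coeff, Polynomial.coeff_C_mul, Polynomial.coeff_X_pow] at this
    rw [Finset.sum_eq_single k₀] at this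
    · simpa using this
    · intro k _ hk
      rw [if_neg, mul_zero]
      intro h; exact hk (Fin.ext h.symm)
    · simp
  have hqw : Polynomial.aeval S q w = 0 := by
    simpa [q, LinearMap.sum_apply, Module.algebraMap_end_apply] using hrel
  rw [(IsAlgClosed.splits q).eq_prod_roots, map_mul, Polynomial.aeval_C, Module.End.mul_apply,
    Module.algebraMap_end_apply, smul_eq_zero] at hqw
  exact exists_eigen_aux S W hzW _ w hw hw0
    (hqw.resolve_left (Polynomial.leadingCoeff_ne_zero.2 hq))

end Casimir

section Forms

variable {L : Type*} [LieRing L] [LieAlgebra ℂ L] {n : ℕ}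

/-- the action on forms -/
noncomputable def frmAct (x : L) (f : MultilinearMap ℂ (fun _ : Fin n => L) ℂ) :
    MultilinearMap ℂ (fun _ : Fin n => L) ℂ :=
  -∑ i, f.compLinearMap (Function.update (fun _ => LinearMap.id) i (LieAlgebra.ad ℂ L x))

lemma frmAct_apply (x : L) (f : MultilinearMap ℂ (fun _ : Fin n => L) ℂ) (v : Fin n → L) :
    frmAct x f v = -∑ i, f (Function.update v i ⁅x, v i⁆) := by
  rw [frmAct, MultilinearMap.neg_apply, MultilinearMap.sum_apply]
  congr 1
  refine Finset.sum_congr rfl fun i _ => ?_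
  rw [MultilinearMap.compLinearMap_apply]
  congr 1
  ext j
  by_cases h : j = i
  · subst h; simp
  · simp [h]

lemma frm_aux (x y : L) (f : MultilinearMap ℂ (fun _ : Fin n => L) ℂ) (v : Fin n → L) (i j : Fin n) :
    f (Function.update (Function.update v i ⁅x, v i⁆) j ⁅y, (Function.update v i ⁅x, v i⁆) j⁆) -
    f (Function.update (Function.update v j ⁅y, v j⁆) i ⁅x, (Function.update v j ⁅y, v j⁆) i⁆) =
    if i = j then - f (Function.update v i ⁅⁅x, y⁆, v i⁆) else 0 := by
  split_ifs with h
  · subst h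
    simp only [Function.update_self, Function.update_idem]
    rw [← MultilinearMap.map_update_sub, ← MultilinearMap.map_update_neg, lie_lie, neg_sub]
  · rw [Function.update_of_ne h, Function.update_of_ne (Ne.symm h), Function.update_comm h, sub_self]

noncomputable instance frmLRM : LieRingModule L (MultilinearMap ℂ (fun _ : Fin n => L) ℂ) where
  bracket := frmAct
  add_lie x y f := by
    ext v
    show frmAct _ _ v = frmAct _ _ v + frmAct _ _ v
    simp only [frmAct_apply, add_lie, MultilinearMap.map_update_add, Finset.sum_add_distrib, neg_add]
  lie_add x f g := by
    ext v
    show frmAct _ _ v = frmAct _ _ v + frmAct _ _ v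
    simp only [frmAct_apply, MultilinearMap.add_apply, Finset.sum_add_distrib, neg_add]
  leibniz_lie x y f := by
    ext v
    show frmAct _ (frmAct _ _) v = frmAct _ _ v + frmAct _ (frmAct _ _) v
    simp only [frmAct_apply, Finset.sum_neg_distrib, neg_neg]
    rw [← sub_eq_iff_eq_add]
    rw [Finset.sum_comm (f := fun i j => f (Function.update (Function.update v i ⁅y, v i⁆) j
      ⁅x, (Function.update v i ⁅y, v i⁆) j⁆))]
    simp only [← Finset.sum_sub_distrib, frm_aux]
    simp

lemma frm_lie_apply (x : L) (f : MultilinearMap ℂ (fun _ : Fin n => L) ℂ) (v : Fin n → L) :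
    ⁅x, f⁆ v = -∑ i, f (Function.update v i ⁅x, v i⁆) := frmAct_apply x f v

instance frmLM : LieModule ℂ L (MultilinearMap ℂ (fun _ : Fin n => L) ℂ) where
  smul_lie c x f := by
    ext v
    simp only [frm_lie_apply, MultilinearMap.smul_apply, smul_lie, MultilinearMap.map_update_smul,
      ← Finset.smul_sum, smul_neg]
  lie_smul c x f := by
    ext v
    simp only [frm_lie_apply, MultilinearMap.smul_apply, ← Finset.smul_sum, smul_neg]

/-- derivation of an alternating map -/
noncomputable def altD {Q : Type*} [AddCommGroup Q] [Module ℂ Q] (A : Q →ₗ[ℂ] Q)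
    (f : Q [⋀^Fin n]→ₗ[ℂ] ℂ) : Q [⋀^Fin n]→ₗ[ℂ] ℂ where
  toMultilinearMap := ∑ i, f.toMultilinearMap.compLinearMap (Function.update (fun _ => LinearMap.id) i A)
  map_eq_zero_of_eq' := by
    intro v i j hv hij
    show (∑ k, f.toMultilinearMap.compLinearMap (Function.update (fun _ => LinearMap.id) k A)) v = 0
    have h : ∀ k, (f.toMultilinearMap.compLinearMap (Function.update (fun _ => LinearMap.id) k A)) v
        = f (Function.update v k (A (v k))) := by
      intro k
      rw [MultilinearMap.compLinearMap_apply]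
      show f _ = f _
      congr 1
      ext j
      by_cases h : j = k
      · subst h; simp
      · simp [h]
    rw [MultilinearMap.sum_apply]
    simp only [h]
    rw [← Finset.sum_subset (Finset.subset_univ {i, j}), Finset.sum_pair hij]
    · have h1 : Function.update v j (A (v j)) = Function.update v i (A (v i)) ∘ Equiv.swap i j := by
        ext k
        simp only [Function.comp, Equiv.swap_apply_def]
        split_ifs with h1 h2
        · subst h1; rw [Function.update_of_ne hij, Function.update_of_ne (Ne.symm hij)]; exact hv
        · subst h2; simp [hv]
        · rw [Function.update_of_ne h2, Function.update_of_ne h1]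
      rw [h1, AlternatingMap.map_swap _ _ hij, add_neg_cancel]
    · intro k _ hk
      simp only [Finset.mem_insert, Finset.mem_singleton, not_or] at hk
      apply f.map_eq_zero_of_eq _ _ hij
      rw [Function.update_of_ne (Ne.symm hk.1), Function.update_of_ne (Ne.symm hk.2), hv]

lemma altD_apply {Q : Type*} [AddCommGroup Q] [Module ℂ Q] (A : Q →ₗ[ℂ] Q)
    (f : Q [⋀^Fin n]→ₗ[ℂ] ℂ) (v : Fin n → Q) :
    altD A f v = ∑ i, f (Function.update v i (A (v i))) := by
  show (∑ k, f.toMultilinearMap.compLinearMap (Function.update (fun _ => LinearMap.id) k A)) v = _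
  rw [MultilinearMap.sum_apply]
  refine Finset.sum_congr rfl fun k _ => ?_
  rw [MultilinearMap.compLinearMap_apply]
  show f _ = f _
  congr 1
  ext j
  by_cases h : j = k
  · subst h; simp
  · simp [h]

variable (P : Submodule ℂ L) (b : Basis (Fin n) ℂ (L ⧸ P))

/-- the determinant form -/
noncomputable def dForm : MultilinearMap ℂ (fun _ : Fin n => L) ℂ :=
  b.det.toMultilinearMap.compLinearMap (fun _ => P.mkQ)

lemma dForm_apply (v : Fin n → L) : dForm P b v = b.det (fun i => P.mkQ (v i)) := rfl

lemma exists_lift : ∃ v : Fin n → L, ∀ i, P.mkQ (v i) = b i := by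
  choose v hv using fun i => P.mkQ_surjective (b i)
  exact ⟨v, hv⟩

lemma dForm_ne : dForm P b ≠ 0 := by
  obtain ⟨v, hv⟩ := exists_lift P b
  intro h
  have := congrArg (fun f => f v) h
  simp only [dForm_apply, hv] at this
  rw [show (fun i => b i) = b from rfl, b.det_self] at this
  simp at this

lemma dForm_semi (x : L) (hx : ∀ y ∈ P, ⁅x, y⁆ ∈ P) : ∃ c : ℂ, ⁅x, dForm P b⁆ = c • dForm P b := by
  let A : (L ⧸ P) →ₗ[ℂ] (L ⧸ P) := P.mapQ P (LieAlgebra.ad ℂ L x) (fun y hy => hx y hy)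
  refine ⟨-(altD A b.det b), ?_⟩
  ext v
  have h := congrArg (fun f => f (fun i => P.mkQ (v i))) (AlternatingMap.eq_smul_basis_det b (altD A b.det))
  simp only [altD_apply, AlternatingMap.smul_apply] at h
  rw [frm_lie_apply, MultilinearMap.smul_apply, dForm_apply, neg_smul, altD_apply, ← h]
  congr 1
  refine Finset.sum_congr rfl fun i _ => ?_
  rw [dForm_apply]
  congr 1
  ext j
  by_cases h : j = i
  · subst h; simp only [Function.update_self, A]; rfl
  · simp only [Function.update_of_ne h]

/-- nonvanishing -/
lemma dForm_nonvan (f h : L) (hf : f ∉ P) (hh : h ∈ P) (c : ℂ) (hc : c ≠ 0) (hfh : ⁅f, h⁆ = c • f) :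
    ⁅f, dForm P b⁆ ≠ 0 := by
  obtain ⟨v, hv⟩ := exists_lift P b
  obtain ⟨i, hi⟩ : ∃ i, b.repr (P.mkQ f) i ≠ 0 := by
    by_contra! hcon
    apply hf
    rw [← Submodule.Quotient.mk_eq_zero, ← Submodule.mkQ_apply]
    apply b.repr.injective
    ext i; simpa using hcon i
  intro h0
  have h1 := congrArg (fun g => g (Function.update v i h)) h0
  simp only [frm_lie_apply, MultilinearMap.zero_apply, neg_eq_zero] at h1
  rw [Finset.sum_eq_single i] at h1
  · rw [Function.update_idem, Function.update_self, hfh, MultilinearMap.map_update_smul, smul_eq_zero] at h1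
    have h2 := h1.resolve_left hc
    rw [dForm_apply] at h2
    have h3 : (fun j => P.mkQ (Function.update v i f j)) = Function.update b i (P.mkQ f) := by
      ext j
      by_cases h : j = i
      · subst h; simp
      · simp only [Function.update_of_ne h, hv]
    rw [h3] at h2
    have h4 : P.mkQ f = ∑ j, b.repr (P.mkQ f) j • b j := (b.sum_repr _).symm
    rw [h4, AlternatingMap.map_update_sum] at h2
    rw [Finset.sum_eq_single i] at h2
    · rw [AlternatingMap.map_update_smul, Function.update_eq_self, b.det_self] at h2
      simp at h2; exact hi h2
    · intro j _ hj
      rw [AlternatingMap.map_update_smul, AlternatingMap.map_update_self _ _ (Ne.symm hj), smul_zero]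
    · simp
  · intro j _ hj
    rw [dForm_apply]
    apply AlternatingMap.map_coord_zero _ i
    rw [Function.update_of_ne (Ne.symm hj), Function.update_self]
    simpa using hh
  · simp

end Forms

section Struct

variable {L : Type*} [LieRing L] [LieAlgebra ℂ L] [FiniteDimensional ℂ L]
  [LieAlgebra.IsKilling ℂ L] (H : LieSubalgebra ℂ L) [H.IsCartanSubalgebra]

lemma mem_gSpace {α : Module.Dual ℂ H} {x : L} :
    x ∈ gSpace H α ↔ ∀ h : H, ⁅(h : L), x⁆ = α h • x := Iff.rfl

lemma mem_gSpace_iff_rootSpace {α : Module.Dual ℂ H} {x : L} :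
    x ∈ gSpace H α ↔ x ∈ LieAlgebra.rootSpace H α := by
  constructor
  · intro hx
    refine LieModule.weightSpace_le_genWeightSpace L _ ?_
    rw [LieModule.mem_weightSpace]
    exact hx
  · intro hx h
    exact LieAlgebra.IsKilling.lie_eq_smul_of_mem_rootSpace hx h

lemma gSpace_zero : gSpace H 0 = (H : Submodule ℂ L) := by
  ext x
  rw [mem_gSpace_iff_rootSpace]
  have := LieAlgebra.rootSpace_zero_eq ℂ L H
  rw [show ((0 : Module.Dual ℂ H) : H → ℂ) = 0 from rfl, this]
  simp

lemma gSpace_lie {α β : Module.Dual ℂ H} {x y : L} (hx : x ∈ gSpace H α) (hy : y ∈ gSpace H β) :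
    ⁅x, y⁆ ∈ gSpace H (α + β) := by
  intro h
  rw [leibniz_lie, hx h, hy h, smul_lie, lie_smul, LinearMap.add_apply, add_smul]

lemma iSup_gSpace : ⨆ α, gSpace H α = ⊤ := by
  rw [eq_top_iff]
  have h := LieModule.iSup_genWeightSpace_eq_top' ℂ H L
  rw [← LieSubmodule.toSubmodule_inj, LieSubmodule.iSup_toSubmodule] at h
  rw [← LieSubmodule.top_toSubmodule (R := ℂ) (L := H), ← h]
  refine iSup_le fun χ => ?_
  refine le_trans ?_ (le_iSup _ (LieModule.Weight.toLinear ℂ H L χ))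
  intro x hx
  rw [mem_gSpace_iff_rootSpace]
  exact hx

lemma killing_gSpace {α β : Module.Dual ℂ H} {x y : L} (hx : x ∈ gSpace H α) (hy : y ∈ gSpace H β)
    (h : α + β ≠ 0) : killingForm ℂ L x y = 0 := by
  rw [mem_gSpace_iff_rootSpace] at hx hy
  refine LieAlgebra.killingForm_apply_eq_zero_of_mem_rootSpace_of_add_ne_zero ℂ L H hx hy ?_
  intro h'
  apply h
  ext z
  exact congrFun h' z

lemma exists_triple {α : Module.Dual ℂ H} (hα : IsRoot H α) :
    ∃ h e f : L, IsSl2Triple h e f ∧ e ∈ gSpace H α ∧ f ∈ gSpace H (-α) ∧ h ∈ H ∧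
      ∃ r : ℝ, 0 < r ∧ ∀ z : H, killingForm ℂ L h z = r * α z := by
  have hne : LieAlgebra.rootSpace H α ≠ ⊥ := by
    intro h
    apply hα.2
    rw [eq_bot_iff]
    intro x hx
    rw [mem_gSpace_iff_rootSpace, h] at hx
    simpa using hx
  let a : LieModule.Weight ℂ H L := ⟨α, hne⟩
  have ha : a.IsNonZero := by
    intro h
    apply hα.1
    ext z
    exact congrFun h z
  obtain ⟨h, e, f, t, he, hf⟩ := LieAlgebra.IsKilling.exists_isSl2Triple_of_weight_isNonZero ha
  have hh := t.h_eq_coroot ha he hf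
  refine ⟨h, e, f, t, ?_, ?_, ?_, ?_⟩
  · rw [mem_gSpace_iff_rootSpace]; exact he
  · rw [mem_gSpace_iff_rootSpace]; exact hf
  · rw [hh]; exact Submodule.coe_mem _
  · let c := LieAlgebra.IsKilling.coroot a
    have h1 : ∀ z : H, killingForm ℂ L h z =
        2 • (a <| (LieAlgebra.IsKilling.cartanEquivDual H).symm a)⁻¹ • α z := by
      intro z
      rw [hh]
      exact LieAlgebra.IsKilling.traceForm_coroot a z
    have h2 : killingForm ℂ L c c = ∑ b ∈ H.root, b c * b c := by
      have := congrArg (fun B => B c c) (LieAlgebra.IsKilling.restrict_killingForm_eq_sum (K := ℂ) (L := L) (H := H))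
      simp only [LinearMap.sum_apply] at this
      exact this
    have hk : ∀ b : LieModule.Weight ℂ H L, ∃ k : ℤ, b c = k :=
      fun b => ⟨_, LieAlgebra.IsKilling.apply_coroot_eq_cast a b⟩
    choose k hk using hk
    have h3 : killingForm ℂ L c c = ((∑ b ∈ H.root, (k b : ℝ) ^ 2 : ℝ) : ℂ) := by
      rw [h2]
      push_cast
      refine Finset.sum_congr rfl fun b _ => ?_
      rw [hk]
      ring
    have h4 : a c = 2 := LieAlgebra.IsKilling.root_apply_coroot ha
    have h5 : (0 : ℝ) < ∑ b ∈ H.root, (k b : ℝ) ^ 2 := by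
      refine Finset.sum_pos' (fun _ _ => sq_nonneg _) ⟨a, by simpa [LieSubalgebra.root] using ha, ?_⟩
      have := hk a
      rw [h4] at this
      have h6 : k a = 2 := by exact_mod_cast this.symm
      rw [h6]; norm_num
    refine ⟨_, half_pos h5, ?_⟩
    intro z
    have h6 := h1 c
    have h7 : α c = 2 := h4
    rw [hh, show LieAlgebra.IsKilling.coroot a = c from rfl, h3, h7] at h6
    rw [h1 z, Complex.ofReal_div, h6]
    simp only [nsmul_eq_mul, smul_eq_mul]
    push_cast
    ring

end Struct

section Grading

variable {L : Type*} [LieRing L] [LieAlgebra ℂ L] (H : LieSubalgebra ℂ L)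
  (Δ θ : Finset (Module.Dual ℂ H))

/-- a grading functional adapted to `θ` -/
def IsPhi (φ : Module.Dual ℂ H →ₗ[ℂ] ℂ) : Prop :=
  (∀ β ∈ θ, φ β = 0) ∧ ∀ β ∈ Δ, β ∉ θ → 0 < (φ β).re

lemma exists_phi (hΔ : IsBase H Δ) (hθ : θ ⊆ Δ) : ∃ φ, IsPhi H Δ θ φ := by
  let g : Δ → ℂ := fun β => if (β : Module.Dual ℂ H) ∈ θ then 0 else 1
  obtain ⟨φ, hφ⟩ := LinearMap.exists_extend ((Basis.span hΔ.2.1).constr ℂ g)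
  have h : ∀ β : Δ, φ β = g β := by
    intro β
    have h1 := congrArg (fun f => f (Basis.span hΔ.2.1 β)) hφ
    simp only [Basis.constr_basis] at h1
    rw [← h1, LinearMap.comp_apply, Submodule.subtype_apply, Basis.span_apply]
  refine ⟨φ, fun β hβ => ?_, fun β hβ hβ' => ?_⟩
  · rw [h ⟨β, hθ hβ⟩]; simp [g, hβ]
  · rw [h ⟨β, hβ⟩]; simp [g, hβ']

variable {Δ θ} {φ : Module.Dual ℂ H →ₗ[ℂ] ℂ}

lemma phi_inSpan (hφ : IsPhi H Δ θ φ) {α : Module.Dual ℂ H} (hα : InSpan H θ α) : φ α = 0 := by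
  obtain ⟨-, c, rfl⟩ := hα
  rw [map_sum]
  refine Finset.sum_eq_zero fun β hβ => ?_
  rw [map_smul, hφ.1 β hβ, smul_zero]

lemma phi_nat (hθ : θ ⊆ Δ) (hφ : IsPhi H Δ θ φ) (c : Module.Dual ℂ H → ℕ) :
    (∑ β ∈ Δ, (c β : ℂ) • β = ∑ β ∈ θ, (c β : ℂ) • β) ∨ 0 < (φ (∑ β ∈ Δ, (c β : ℂ) • β)).re := by
  have hnn : ∀ β ∈ Δ, 0 ≤ (c β : ℝ) * (φ β).re := by
    intro β hβ
    by_cases h : β ∈ θ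
    · rw [hφ.1 β h]; simp
    · exact mul_nonneg (Nat.cast_nonneg _) (hφ.2 β hβ h).le
  have h1 : (φ (∑ β ∈ Δ, (c β : ℂ) • β)).re = ∑ β ∈ Δ, (c β : ℝ) * (φ β).re := by
    simp [map_sum]
  by_cases h : ∃ β ∈ Δ, β ∉ θ ∧ c β ≠ 0
  · right
    obtain ⟨β, hβ, hβ', hc⟩ := h
    rw [h1]
    refine Finset.sum_pos' hnn ⟨β, hβ, ?_⟩
    exact mul_pos (by positivity) (hφ.2 β hβ hβ')
  · left
    push Not at h
    refine (Finset.sum_subset hθ fun β hβ hβ' => ?_).symm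
    rw [h β hβ hβ']; simp

lemma phi_root (hΔ : IsBase H Δ) (hθ : θ ⊆ Δ) (hφ : IsPhi H Δ θ φ) {α : Module.Dual ℂ H}
    (hα : IsRoot H α) :
    (InSpan H θ α ∧ φ α = 0) ∨ (IsPos H Δ α ∧ ¬ InSpan H θ α ∧ 0 < (φ α).re) ∨
    (¬ InSpan H θ α ∧ (φ α).re < 0) := by
  by_cases hs : InSpan H θ α
  · exact Or.inl ⟨hs, phi_inSpan H hφ hs⟩
  right
  rcases hΔ.2.2 α hα with ⟨c, hc⟩ | ⟨c, hc⟩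
  · left
    refine ⟨⟨hα, c, hc⟩, hs, ?_⟩
    rcases phi_nat H hθ hφ c with h | h
    · exact absurd ⟨hα, fun β => c β, by rw [hc, h]; simp⟩ hs
    · rwa [hc]
  · right
    refine ⟨hs, ?_⟩
    rcases phi_nat H hθ hφ c with h | h
    · exact absurd ⟨hα, fun β => -(c β : ℤ), by rw [hc, h]; simp⟩ hs
    · rw [hc, map_neg, Complex.neg_re]; linarith

lemma phi_pos (hθ : θ ⊆ Δ) (hφ : IsPhi H Δ θ φ) {α : Module.Dual ℂ H}
    (hα : IsPos H Δ α) (hs : ¬ InSpan H θ α) : 0 < (φ α).re := by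
  obtain ⟨hα, c, hc⟩ := hα
  rcases phi_nat H hθ hφ c with h | h
  · exact absurd ⟨hα, fun β => c β, by rw [hc, h]; simp⟩ hs
  · rwa [hc]

variable (φ) in
/-- graded pieces -/
def gr (S : Set ℝ) : Submodule ℂ L := ⨆ α ∈ {α | (φ α).re ∈ S}, gSpace H α

lemma gSpace_le_gr {S : Set ℝ} {α : Module.Dual ℂ H} (h : (φ α).re ∈ S) : gSpace H α ≤ gr H φ S :=
  le_biSup (gSpace H) (show α ∈ {α | (φ α).re ∈ S} from h)

lemma gr_le {S : Set ℝ} {P : Submodule ℂ L} (h : ∀ α, (φ α).re ∈ S → gSpace H α ≤ P) :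
    gr H φ S ≤ P := iSup₂_le h

lemma gr_sup (S T : Set ℝ) : gr H φ S ⊔ gr H φ T = gr H φ (S ∪ T) := by
  refine le_antisymm (sup_le ?_ ?_) ?_
  · exact gr_le H fun α h => gSpace_le_gr H (Or.inl h)
  · exact gr_le H fun α h => gSpace_le_gr H (Or.inr h)
  · refine gr_le H fun α h => ?_
    rcases h with h | h
    · exact le_sup_of_le_left (gSpace_le_gr H h)
    · exact le_sup_of_le_right (gSpace_le_gr H h)

variable [FiniteDimensional ℂ L] [LieAlgebra.IsKilling ℂ L] [H.IsCartanSubalgebra]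

lemma gr_univ : gr H φ Set.univ = ⊤ := by
  rw [eq_top_iff, ← iSup_gSpace H]
  exact iSup_le fun α => gSpace_le_gr H (Set.mem_univ _)

lemma gr_lie {S T U : Set ℝ} (h : ∀ s ∈ S, ∀ t ∈ T, s + t ∈ U) {x y : L} (hx : x ∈ gr H φ S)
    (hy : y ∈ gr H φ T) : ⁅x, y⁆ ∈ gr H φ U := by
  have h1 : gr H φ S ≤ (gr H φ U).comap (LieAlgebra.ad ℂ L y) := by
    refine gr_le H fun α hα x hx => ?_
    have h2 : gr H φ T ≤ (gr H φ U).comap (LieAlgebra.ad ℂ L x) := by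
      refine gr_le H fun β hβ y hy => ?_
      refine gSpace_le_gr H (α := α + β) ?_ (gSpace_lie H hx hy)
      rw [map_add, Complex.add_re]
      exact h _ hα _ hβ
    rw [Submodule.mem_comap, LieAlgebra.ad_apply, ← lie_skew]
    exact Submodule.neg_mem _ (h2 hy)
  rw [← lie_skew]
  exact Submodule.neg_mem _ (h1 hx)

lemma gr_killing {S T : Set ℝ} (h : ∀ s ∈ S, ∀ t ∈ T, s + t ≠ 0) {x y : L} (hx : x ∈ gr H φ S)
    (hy : y ∈ gr H φ T) : killingForm ℂ L x y = 0 := by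
  have h1 : gr H φ S ≤ LinearMap.ker ((killingForm ℂ L).flip y) := by
    refine gr_le H fun α hα x hx => ?_
    have h2 : gr H φ T ≤ LinearMap.ker (killingForm ℂ L x) := by
      refine gr_le H fun β hβ y hy => ?_
      refine killing_gSpace H hx hy ?_
      intro h0
      apply h _ hα _ hβ
      rw [← Complex.add_re, ← map_add, h0]; simp
    exact h2 hy
  exact h1 hx

lemma gr_perp {y : L} (hy : ∀ x ∈ gr H φ (Set.Ici 0), killingForm ℂ L y x = 0) :
    y ∈ gr H φ (Set.Ioi 0) := by
  have htop : gr H φ (Set.Ioi 0) ⊔ gr H φ (Set.Iic 0) = ⊤ := by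
    rw [gr_sup, ← gr_univ H (φ := φ)]; congr 1; ext; simp
  have htop' : gr H φ (Set.Ici 0) ⊔ gr H φ (Set.Iio 0) = ⊤ := by
    rw [gr_sup, ← gr_univ H (φ := φ)]; congr 1; ext; simp
  obtain ⟨a, ha, c, hc, rfl⟩ := Submodule.mem_sup.1 (htop ▸ Submodule.mem_top : y ∈ _)
  have hc0 : c = 0 := by
    have hk := LieAlgebra.IsKilling.ker_killingForm_eq_bot ℂ L
    rw [← Submodule.mem_bot ℂ, ← hk, LinearMap.mem_ker]
    ext x
    obtain ⟨u, hu, w, hw, rfl⟩ := Submodule.mem_sup.1 (htop' ▸ Submodule.mem_top : x ∈ _)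
    have e1 : killingForm ℂ L c u = 0 := by
      have := hy u hu
      rw [map_add, LinearMap.add_apply, gr_killing H _ ha hu, zero_add] at this
      · exact this
      · intro s hs t ht
        simp only [Set.mem_Ioi, Set.mem_Ici] at hs ht
        linarith
    have e2 : killingForm ℂ L c w = 0 := by
      refine gr_killing H ?_ hc hw
      intro s hs t ht
      simp only [Set.mem_Iio, Set.mem_Iic] at hs ht
      linarith
    rw [map_add, e1, e2]; simp
  rw [hc0, add_zero]; exact ha

lemma levi_eq (hΔ : IsBase H Δ) (hθ : θ ⊆ Δ) (hφ : IsPhi H Δ θ φ) : levi H θ = gr H φ {0} := by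
  refine le_antisymm (sup_le ?_ (iSup₂_le ?_)) (gr_le H ?_)
  · rw [← gSpace_zero]; exact gSpace_le_gr H (by simp)
  · intro α hα
    exact gSpace_le_gr H (by rw [phi_inSpan H hφ hα]; simp)
  · intro α hα
    by_cases hb : gSpace H α = ⊥
    · rw [hb]; exact bot_le
    by_cases h0 : α = 0
    · rw [h0, gSpace_zero]; exact le_sup_left
    · have hα' : (φ α).re = 0 := hα
      rcases phi_root H hΔ hθ hφ ⟨h0, hb⟩ with h | h | h
      · exact le_sup_of_le_right (le_biSup (gSpace H) (show α ∈ {α | InSpan H θ α} from h.1))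
      · linarith [h.2.2]
      · linarith [h.2]

lemma nPlus_eq (hΔ : IsBase H Δ) (hθ : θ ⊆ Δ) (hφ : IsPhi H Δ θ φ) :
    nPlus H Δ θ = gr H φ (Set.Ioi 0) := by
  refine le_antisymm (iSup₂_le ?_) (gr_le H ?_)
  · intro α hα
    exact gSpace_le_gr H (phi_pos H hθ hφ hα.1 hα.2)
  · intro α hα
    have hα' : 0 < (φ α).re := hα
    by_cases hb : gSpace H α = ⊥
    · rw [hb]; exact bot_le
    by_cases h0 : α = 0
    · rw [h0] at hα'; simp at hα'
    · rcases phi_root H hΔ hθ hφ ⟨h0, hb⟩ with h | h | h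
      · rw [h.2] at hα'; simp at hα'
      · exact le_biSup (gSpace H) (show α ∈ {α | IsPos H Δ α ∧ ¬ InSpan H θ α} from ⟨h.1, h.2.1⟩)
      · linarith [h.2]

lemma par_eq (hΔ : IsBase H Δ) (hθ : θ ⊆ Δ) (hφ : IsPhi H Δ θ φ) :
    par H Δ θ = gr H φ (Set.Ici 0) := by
  rw [par, levi_eq H hΔ hθ hφ, nPlus_eq H hΔ hθ hφ, gr_sup]
  congr 1; ext; simp [le_iff_eq_or_lt, eq_comm]

end Grading

section ZElt

variable {L : Type*} [LieRing L] [LieAlgebra ℂ L] [FiniteDimensional ℂ L]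
  [LieAlgebra.IsKilling ℂ L] (H : LieSubalgebra ℂ L) [H.IsCartanSubalgebra]
  {Δ θ : Finset (Module.Dual ℂ H)}

lemma exists_z (hΔ : IsBase H Δ) (hθ : θ ⊆ Δ) (M : Type*) [AddCommGroup M] [Module ℂ M]
    [LieRingModule L M] [LieModule ℂ L M] [LieModule.IsIrreducible ℂ L M] :
    ∃ z : H, IsPhi H Δ θ (Module.Dual.eval ℂ H z) ∧
      ∀ W : Submodule ℂ M, W ≤ nInv H Δ θ M → W ≠ ⊥ → (∀ w ∈ W, ⁅(z : L), w⁆ ∈ W) →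
        ∃ c : ℂ, ∃ w ∈ W, w ≠ 0 ∧ ⁅(z : L), w⁆ = c • w := by
  obtain ⟨φ, hφ⟩ := exists_phi H Δ θ hΔ hθ
  let P := gr H φ (Set.Ici 0)
  have hPP : ∀ x ∈ P, ∀ y ∈ P, ⁅x, y⁆ ∈ P := by
    intro x hx y hy
    refine gr_lie H ?_ hx hy
    intro s hs t ht
    simp only [Set.mem_Ici] at *
    linarith
  have hHP : ∀ h : H, (h : L) ∈ P := by
    intro h
    have : gSpace H 0 ≤ P := gSpace_le_gr H (by simp)
    rw [gSpace_zero] at this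
    exact this h.2
  let b := finBasis ℂ (L ⧸ P)
  let e := dForm P b
  have he : e ≠ 0 := dForm_ne P b
  obtain ⟨ξ₀, hξ₀⟩ := Module.Projective.exists_dual_eq_one ℂ he
  let χ : L →ₗ[ℂ] ℂ := 
    { toFun := fun x => ξ₀ ⁅x, e⁆
      map_add' := by intros; simp
      map_smul' := by intros; simp }
  have hχ : ∀ x ∈ P, ⁅x, e⁆ = χ x • e := by
    intro x hx
    obtain ⟨c, hc⟩ := dForm_semi P b x (hPP x hx)
    have : χ x = c := by
      show ξ₀ ⁅x, e⁆ = c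
      rw [show ⁅x, e⁆ = c • e from hc, map_smul, hξ₀]; simp
    rw [this]; exact hc
  have hχχ : ∀ x ∈ P, ∀ y ∈ P, χ ⁅x, y⁆ = 0 := by
    intro x hx y hy
    show ξ₀ ⁅⁅x, y⁆, e⁆ = 0
    rw [lie_lie, hχ x hx, hχ y hy, lie_smul, lie_smul, hχ x hx, hχ y hy, smul_comm, sub_self, map_zero]
  let z : H := (LieAlgebra.IsKilling.cartanEquivDual H).symm (χ ∘ₗ (H : Submodule ℂ L).subtype)
  have hzH : ∀ h : H, killingForm ℂ L (z : L) h = χ h := by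
    intro h
    have := LinearMap.congr_fun ((LieAlgebra.IsKilling.cartanEquivDual H).apply_symm_apply
      (χ ∘ₗ (H : Submodule ℂ L).subtype)) h
    exact this
  have hz0 : (z : L) ∈ gSpace H 0 := by rw [gSpace_zero]; exact z.2
  have hzP : ∀ x ∈ P, killingForm ℂ L (z : L) x = χ x := by
    intro x hx
    have hle : P ≤ LinearMap.ker (killingForm ℂ L (z : L) - χ) := by
      refine gr_le H fun α hα x hx => ?_
      rw [LinearMap.mem_ker, LinearMap.sub_apply, sub_eq_zero]
      by_cases h0 : α = 0
      · subst h0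
        rw [gSpace_zero] at hx
        exact hzH ⟨x, hx⟩
      · rw [killing_gSpace H hz0 hx (by simpa using h0)]
        obtain ⟨h, hh⟩ : ∃ h : H, α h ≠ 0 := by
          by_contra! hcon
          exact h0 (LinearMap.ext hcon)
        have := hχχ h (hHP h) x (gSpace_le_gr H hα hx)
        rw [hx h, map_smul, smul_eq_zero] at this
        exact (this.resolve_left hh).symm
    have := hle hx
    rwa [LinearMap.mem_ker, LinearMap.sub_apply, sub_eq_zero] at this
  refine ⟨z, ⟨?_, ?_⟩, ?_⟩
  · intro β hβ
    have hroot := hΔ.1 β (hθ hβ)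
    have hφβ := hφ.1 β hβ
    obtain ⟨h, x, y, t, hx, hy, hh, r, hr, hrz⟩ := exists_triple H hroot
    have h1 : χ h = 0 := by
      rw [← t.lie_e_f]
      refine hχχ x (gSpace_le_gr H ?_ hx) y (gSpace_le_gr H ?_ hy)
      · simp [hφβ]
      · simp [hφβ]
    have h2 := hrz z
    rw [killing_comm, hzH ⟨h, hh⟩, h1] at h2
    have h3 := (mul_eq_zero.1 h2.symm).resolve_left (by exact_mod_cast hr.ne')
    exact h3
  · intro β hβ hβ'
    have hroot := hΔ.1 β hβ
    have hφβ := hφ.2 β hβ hβ'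
    obtain ⟨h, x, y, t, hx, hy, hh, r, hr, hrz⟩ := exists_triple H hroot
    have hxP : x ∈ P := gSpace_le_gr H hφβ.le hx
    have hhP : h ∈ P := hHP ⟨h, hh⟩
    have htf : IsAddTorsionFree (MultilinearMap ℂ (fun _ : Fin (finrank ℂ (L ⧸ P)) => L) ℂ) :=
      .of_isTorsionFree ℂ _
    have hprim : t.HasPrimitiveVectorWith e (χ h) := 
      IsSl2Triple.HasPrimitiveVectorWith.mk' t e (χ h) (χ x) he (hχ h hhP) (hχ x hxP)
    obtain ⟨n, hn⟩ := hprim.exists_nat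
    have hyP : y ∉ P := by
      intro hyP
      apply t.f_ne_zero
      have hk := LieAlgebra.IsKilling.ker_killingForm_eq_bot ℂ L
      rw [← Submodule.mem_bot ℂ, ← hk, LinearMap.mem_ker]
      have hyN : y ∈ gr H φ (Set.Iio 0) := gSpace_le_gr H (by simpa using hφβ) hy
      have htop' : gr H φ (Set.Ioi 0) ⊔ gr H φ (Set.Iic 0) = ⊤ := by
        rw [gr_sup, ← gr_univ H (φ := φ)]; congr 1; ext; simp
      ext v
      obtain ⟨u, hu, w, hw, rfl⟩ := Submodule.mem_sup.1 (htop' ▸ Submodule.mem_top : v ∈ _)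
      rw [map_add, gr_killing H _ hyP hu, gr_killing H _ hyN hw]
      · simp
      · intro s hs t ht
        simp only [Set.mem_Iio, Set.mem_Iic] at hs ht
        linarith
      · intro s hs t ht
        simp only [Set.mem_Ioi, Set.mem_Ici] at hs ht
        linarith
    have hn0 : n ≠ 0 := by
      rintro rfl
      have h1 := hprim.pow_toEnd_f_eq_zero_of_eq_nat hn
      refine dForm_nonvan P b y h hyP hhP 2 two_ne_zero ?_ (by simpa using h1)
      rw [← lie_skew, t.lie_lie_smul_f ℂ, neg_neg]
    have h2 := hrz z
    rw [killing_comm, hzH ⟨h, hh⟩, hn] at h2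
    have h3 := congrArg Complex.re h2
    rw [Complex.re_ofReal_mul] at h3
    have h4 : (0 : ℝ) < r * (β z).re := by
      rw [← h3]; simpa using Nat.pos_of_ne_zero hn0
    exact pos_of_mul_pos_right h4 hr.le
  · intro W hWn hW hzW
    refine exists_eigen _ e he (z : L) W hW hzW ?_
    intro y ξ hy w hw
    have hmem : y - ξ e • (z : L) ∈ gr H φ (Set.Ioi 0) := by
      refine gr_perp H fun x hx => ?_
      rw [map_sub, LinearMap.sub_apply, hy x, map_smul, LinearMap.smul_apply, hzP x hx, hχ x hx,
        map_smul, smul_eq_mul, smul_eq_mul, mul_comm, sub_self]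
    rw [← nPlus_eq H hΔ hθ hφ] at hmem
    have := hWn hw _ hmem
    rwa [sub_lie, smul_lie, sub_eq_zero] at this

end ZElt

section Final

variable {L : Type*} [LieRing L] [LieAlgebra ℂ L] [FiniteDimensional ℂ L]
  [LieAlgebra.IsKilling ℂ L] (H : LieSubalgebra ℂ L) [H.IsCartanSubalgebra]
  {Δ θ : Finset (Module.Dual ℂ H)}
  {M : Type*} [AddCommGroup M] [Module ℂ M]
  [LieRingModule L M] [LieModule ℂ L M] 

/-- the filtration generated by a subspace and a subspace of the Lie algebra -/
def nfil (N : Submodule ℂ L) (W : Submodule ℂ M) : ℕ → Submodule ℂ M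
  | 0 => W
  | k + 1 => nfil N W k ⊔ Submodule.span ℂ {m | ∃ y ∈ N, ∃ u ∈ nfil N W k, m = ⁅y, u⁆}

lemma nfil_mono (N : Submodule ℂ L) (W : Submodule ℂ M) : Monotone (nfil N W) :=
  monotone_nat_of_le_succ fun _ => le_sup_left

lemma lie_mem_nfil {N : Submodule ℂ L} {W : Submodule ℂ M} {k : ℕ} {y : L} {u : M} (hy : y ∈ N)
    (hu : u ∈ nfil N W k) : ⁅y, u⁆ ∈ nfil N W (k + 1) :=
  (le_sup_right : _ ≤ nfil N W (k + 1)) (Submodule.subset_span ⟨y, hy, u, hu, rfl⟩)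

lemma nfil_stable {N P : Submodule ℂ L} {W : Submodule ℂ M} (htop : ∀ x : L, ∃ a ∈ N, ∃ b ∈ P, x = a + b)
    (hW : ∀ x ∈ P, ∀ w ∈ W, ⁅x, w⁆ ∈ W) (k : ℕ) :
    ∀ x ∈ P, ∀ w ∈ nfil N W k, ⁅x, w⁆ ∈ nfil N W k := by
  induction k with
  | zero => exact hW
  | succ k ih =>
    have hg : ∀ x : L, ∀ w ∈ nfil N W k, ⁅x, w⁆ ∈ nfil N W (k + 1) := by
      intro x w hw
      obtain ⟨a, ha, b, hb, rfl⟩ := htop x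
      rw [add_lie]
      exact Submodule.add_mem _ (lie_mem_nfil ha hw) (nfil_mono N W (Nat.le_succ k) (ih b hb w hw))
    intro x hx w hw
    have hle : nfil N W (k + 1) ≤ (nfil N W (k + 1)).comap (LieModule.toEnd ℂ L M x) := by
      refine sup_le (fun w hw => hg x w hw) (Submodule.span_le.2 ?_)
      rintro _ ⟨y, hy, u, hu, rfl⟩
      show ⁅x, ⁅y, u⁆⁆ ∈ nfil N W (k + 1)
      rw [leibniz_lie]
      exact Submodule.add_mem _ (hg _ _ hu) (lie_mem_nfil hy (ih x hx u hu))
    exact hle hw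

lemma nfil_top [LieModule.IsIrreducible ℂ L M] {N P : Submodule ℂ L} {W : Submodule ℂ M}
    (htop : ∀ x : L, ∃ a ∈ N, ∃ b ∈ P, x = a + b)
    (hW : ∀ x ∈ P, ∀ w ∈ W, ⁅x, w⁆ ∈ W) (hW0 : W ≠ ⊥) (Q : Submodule ℂ M) (hWQ : W ≤ Q)
    (hQ : ∀ y ∈ N, ∀ u ∈ Q, ⁅y, u⁆ ∈ Q) : Q = ⊤ := by
  have hle : ∀ k, nfil N W k ≤ Q := by
    intro k
    induction k with
    | zero => exact hWQ
    | succ k ih =>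
      refine sup_le ih (Submodule.span_le.2 ?_)
      rintro _ ⟨y, hy, u, hu, rfl⟩
      exact hQ y hy u (ih hu)
  have hdir : Directed (· ≤ ·) (nfil N W) := (nfil_mono N W).directed_le
  let S : LieSubmodule ℂ L M :=
    { toSubmodule := ⨆ k, nfil N W k
      lie_mem := by
        intro x m hm
        obtain ⟨k, hk⟩ := (Submodule.mem_iSup_of_directed _ hdir).1 hm
        obtain ⟨a, ha, b, hb, rfl⟩ := htop x
        refine (Submodule.mem_iSup_of_directed _ hdir).2 ⟨k + 1, ?_⟩
        rw [add_lie]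
        exact Submodule.add_mem _ (lie_mem_nfil ha hk)
          (nfil_mono N W (Nat.le_succ k) (nfil_stable htop hW k b hb _ hk)) }
  have hWS : W ≤ S.toSubmodule := le_iSup (nfil N W) 0
  rcases IsSimpleOrder.eq_bot_or_eq_top S with h | h
  · exfalso
    apply hW0
    rw [eq_bot_iff]
    intro w hw
    have := hWS hw
    rw [h] at this
    simpa using this
  · rw [eq_top_iff]
    intro m _
    have : m ∈ S.toSubmodule := by rw [h]; trivial
    exact (iSup_le hle : (⨆ k, nfil N W k) ≤ Q) this

lemma nInv_stable (hΔ : IsBase H Δ) (hθ : θ ⊆ Δ) : lStableAux H θ (nInv H Δ θ M) := by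
  obtain ⟨φ, hφ⟩ := exists_phi H Δ θ hΔ hθ
  intro x hx m hm y hy
  rw [leibniz_lie, hm y hy, lie_zero, add_zero]
  apply hm
  rw [levi_eq H hΔ hθ hφ] at hx
  rw [nPlus_eq H hΔ hθ hφ] at hy ⊢
  refine gr_lie H ?_ hy hx
  intro s hs t ht
  simp only [Set.mem_Ioi, Set.mem_singleton_iff] at *
  linarith

lemma part_one [LieModule.IsIrreducible ℂ L M] (hΔ : IsBase H Δ) (hθ : θ ⊆ Δ) (W : Submodule ℂ M)
    (hWn : W ≤ nInv H Δ θ M) (hW : W ≠ ⊥) (hWl : lStableAux H θ W) : W = nInv H Δ θ M := by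
  obtain ⟨z, hφ, hz⟩ := exists_z H hΔ hθ M
  have hzl : (z : L) ∈ levi H θ := (le_sup_left : _ ≤ levi H θ) z.2
  obtain ⟨c, w₀, hw₀, hw₀0, hzw₀⟩ := hz W hWn hW (hWl z hzl)
  have hlev := levi_eq H hΔ hθ hφ
  have hnp := nPlus_eq H hΔ hθ hφ
  let N := gr H (Module.Dual.eval ℂ H z) (Set.Iio 0)
  have htop : ∀ x : L, ∃ a ∈ N, ∃ b ∈ par H Δ θ, x = a + b := by
    intro x
    have : N ⊔ par H Δ θ = ⊤ := by
      rw [par_eq H hΔ hθ hφ, gr_sup, ← gr_univ H (φ := Module.Dual.eval ℂ H z)]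
      congr 1; ext; simp
    obtain ⟨a, ha, b, hb, h⟩ := Submodule.mem_sup.1 (this ▸ Submodule.mem_top : x ∈ _)
    exact ⟨a, ha, b, hb, h.symm⟩
  have hpar : ∀ W' : Submodule ℂ M, W' ≤ nInv H Δ θ M → lStableAux H θ W' →
      ∀ x ∈ par H Δ θ, ∀ w ∈ W', ⁅x, w⁆ ∈ W' := by
    intro W' h1 h2 x hx w hw
    obtain ⟨a, ha, b, hb, rfl⟩ := Submodule.mem_sup.1 hx
    rw [add_lie, h1 hw b hb, add_zero]
    exact h2 a ha w hw
  let S := LieModule.toEnd ℂ L M (z : L)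
  -- levi commutes with z
  have hcomm : ∀ x ∈ levi H θ, ⁅(z : L), x⁆ = 0 := by
    intro x hx
    have hle : levi H θ ≤ LinearMap.ker (LieAlgebra.ad ℂ L (z : L)) := by
      refine sup_le ?_ (iSup₂_le ?_)
      · rw [← gSpace_zero]
        intro x hx
        rw [LinearMap.mem_ker, LieAlgebra.ad_apply, hx z]; simp
      · intro α hα x hx
        have h0 : α z = 0 := phi_inSpan H hφ hα
        rw [LinearMap.mem_ker, LieAlgebra.ad_apply, hx z, h0, zero_smul]
    exact hle hx
  have hlS : ∀ x ∈ levi H θ, ∀ μ : ℂ, ∀ m ∈ S.eigenspace μ, ⁅x, m⁆ ∈ S.eigenspace μ := by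
    intro x hx μ m hm
    rw [Module.End.mem_eigenspace_iff] at hm ⊢
    have hm' : ⁅(z : L), m⁆ = μ • m := hm
    show ⁅(z : L), ⁅x, m⁆⁆ = _
    rw [leibniz_lie, hcomm x hx, zero_lie, zero_add, hm', lie_smul]
  let R : Submodule ℂ M := ⨆ μ ∈ {μ : ℂ | μ.re < c.re}, S.eigenspace μ
  have hR : ∀ μ : ℂ, μ.re < c.re → S.eigenspace μ ≤ R := fun μ h =>
    le_biSup (f := fun μ => S.eigenspace μ) (show μ ∈ {μ : ℂ | μ.re < c.re} from h)
  let V := W ⊓ S.eigenspace c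
  have hVl : lStableAux H θ V := fun x hx m hm => ⟨hWl x hx m hm.1, hlS x hx c m hm.2⟩
  have hw₀V : w₀ ∈ V := ⟨hw₀, Module.End.mem_eigenspace_iff.2 hzw₀⟩
  have hV0 : V ≠ ⊥ := by
    intro h
    rw [h] at hw₀V
    exact hw₀0 (by simpa using hw₀V)
  have hRl : lStableAux H θ R := by
    intro x hx m hm
    have hle : R ≤ R.comap (LieModule.toEnd ℂ L M x) :=
      iSup₂_le fun μ hμ m hm => hR μ hμ (hlS x hx μ m hm)
    exact hle hm
  -- lowering
  have hlow : ∀ y ∈ N, ∀ μ : ℂ, μ.re ≤ c.re → ∀ m ∈ S.eigenspace μ, ⁅y, m⁆ ∈ R := by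
    intro y hy μ hμ m hm
    have hm' : ⁅(z : L), m⁆ = μ • m := Module.End.mem_eigenspace_iff.1 hm
    have hle : N ≤ R.comap ((LieModule.toEnd ℂ L M : L →ₗ[ℂ] (M →ₗ[ℂ] M)).flip m) := by
      refine gr_le H fun α hα y hy => ?_
      have hα' : (α z).re < 0 := hα
      refine hR (α z + μ) (by rw [Complex.add_re]; linarith) ?_
      rw [Module.End.mem_eigenspace_iff]
      show ⁅(z : L), ⁅y, m⁆⁆ = _
      rw [leibniz_lie, hy z, hm', smul_lie, lie_smul, ← add_smul]
      rfl
    exact hle hy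
  have hRN : ∀ y ∈ N, ∀ m ∈ R, ⁅y, m⁆ ∈ R := by
    intro y hy m hm
    have hle : R ≤ R.comap (LieModule.toEnd ℂ L M y) :=
      iSup₂_le fun μ hμ m hm => hlow y hy μ (le_of_lt hμ) m hm
    exact hle hm
  have hVR : V ⊔ R = ⊤ := by
    refine nfil_top htop (hpar V (inf_le_left.trans hWn) hVl) hV0 _ le_sup_left ?_
    intro y hy u hu
    obtain ⟨a, ha, r, hr, rfl⟩ := Submodule.mem_sup.1 hu
    rw [lie_add]
    exact (le_sup_right : R ≤ V ⊔ R) (Submodule.add_mem _ (hlow y hy c le_rfl a ha.2) (hRN y hy r hr))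
  have hdisj : Disjoint (S.eigenspace c) R := by
    have hind := S.eigenspaces_iSupIndep
    exact hind.disjoint_biSup (by simp)
  have hRinv : nInv H Δ θ M ⊓ R = ⊥ := by
    by_contra hne
    have hRt := nfil_top htop (hpar (nInv H Δ θ M ⊓ R) inf_le_left
      (fun x hx m hm => ⟨nInv_stable H hΔ hθ x hx m hm.1, hRl x hx m hm.2⟩)) hne R inf_le_right hRN
    rw [hRt, disjoint_top] at hdisj
    have := hw₀V.2
    rw [hdisj] at this
    exact hw₀0 (by simpa using this)
  refine le_antisymm hWn fun v hv => ?_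
  obtain ⟨a, ha, r, hr, rfl⟩ := Submodule.mem_sup.1 (hVR ▸ Submodule.mem_top : v ∈ _)
  have hr' : r ∈ nInv H Δ θ M ⊓ R := by
    refine ⟨?_, hr⟩
    have := Submodule.sub_mem _ hv (hWn ha.1)
    simpa using this
  rw [hRinv, Submodule.mem_bot] at hr'
  rw [hr', add_zero]
  exact ha.1

end Final

section PartTwo

universe w w1 w2 w3 w4

/-- transported bracket -/
abbrev transLRM {L : Type*} [LieRing L] [LieAlgebra ℂ L] {M M' : Type*} [AddCommGroup M] [Module ℂ M]
    [LieRingModule L M] [LieModule ℂ L M] [AddCommGroup M'] [Module ℂ M'] (s : M' ≃ₗ[ℂ] M) :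
    LieRingModule L M' where
  bracket x m := s.symm ⁅x, s m⁆
  add_lie x y m := by simp
  lie_add x m m' := by simp
  leibniz_lie x y m := by simp

lemma part_two {L : Type w1} [LieRing L] [LieAlgebra ℂ L] [FiniteDimensional ℂ L]
    {M : Type w2} [AddCommGroup M] [Module ℂ M] [LieRingModule L M] [LieModule ℂ L M]
    [LieModule.IsIrreducible ℂ L M] (U : Submodule ℂ M) (hU : U ≠ ⊥) (p : LieSubalgebra ℂ L)
    (N : Type w3) [AddCommGroup N] [Module ℂ N] [LieRingModule p N] [LieModule ℂ p N]
    (e : N ≃ₗ[ℂ] U) (he : ∀ (x : p) (n : N), (e ⁅x, n⁆ : M) = ⁅(x : L), (e n : M)⁆)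
    (V : Type w4) [AddCommGroup V] [Module ℂ V] [LieRingModule L V] [LieModule ℂ L V]
    (i : N →ₗ[ℂ] V) (hi : IsGVM.{w1, w3, w4, w} p N V i) :
    ∃ φ : V →ₗ⁅ℂ,L⁆ M, Function.Surjective φ ∧ ∀ n : N, φ (i n) = e n := by
  obtain ⟨-, -, h3⟩ := hi
  haveI : Small.{w} M := small_irr L M
  let s : Shrink.{w} M ≃ₗ[ℂ] M := Shrink.linearEquiv ℂ M
  letI : LieRingModule L (Shrink.{w} M) := transLRM s
  have hb : ∀ (x : L) (m : Shrink.{w} M), ⁅x, m⁆ = s.symm ⁅x, s m⁆ := fun _ _ => rfl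
  haveI : LieModule ℂ L (Shrink.{w} M) :=
    { smul_lie := by intro c x m; simp [hb]
      lie_smul := by intro c x m; simp [hb] }
  obtain ⟨φ, hφ, -⟩ := h3 (Shrink.{w} M) (s.symm.toLinearMap ∘ₗ U.subtype ∘ₗ e.toLinearMap) (by
    intro x n
    simp [hb, he])
  let ψ : V →ₗ⁅ℂ,L⁆ M :=
    { toLinearMap := s.toLinearMap ∘ₗ φ.toLinearMap
      map_lie' := by
        intro x v
        show s (φ ⁅x, v⁆) = ⁅x, s (φ v)⁆
        rw [LieModuleHom.map_lie, hb, LinearEquiv.apply_symm_apply] }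
  have hψ : ∀ n, ψ (i n) = e n := by
    intro n
    show s (φ (i n)) = _
    rw [hφ]; simp
  refine ⟨ψ, ?_, hψ⟩
  rw [← LieModuleHom.range_eq_top]
  rcases IsSimpleOrder.eq_bot_or_eq_top ψ.range with h | h
  · exfalso
    apply hU
    rw [eq_bot_iff]
    intro u hu
    have h1 : ψ (i (e.symm ⟨u, hu⟩)) ∈ ψ.range := ⟨_, rfl⟩
    rw [h, hψ, LinearEquiv.apply_symm_apply] at h1
    simpa using h1
  · exact h

end PartTwo

/-- If `M` is a simple `g`-module with `M^{n⁺_θ} ≠ 0`, then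
`M^{n⁺_θ}` is a simple `l_θ`-module and `M ≅ L(θ, M^{n⁺_θ})`, the unique simple
quotient of the generalized Verma module `V(θ, M^{n⁺_θ})`. -/
theorem simple_module_with_invariants_is_induced
    {L : Type*} [LieRing L] [LieAlgebra ℂ L] [FiniteDimensional ℂ L]
    [LieAlgebra.IsSimple ℂ L]
    (H : LieSubalgebra ℂ L) [H.IsCartanSubalgebra]
    (Δ : Finset (Module.Dual ℂ H)) (hΔ : IsBase H Δ)
    (θ : Finset (Module.Dual ℂ H)) (hθ : θ ⊆ Δ)
    (M : Type*) [AddCommGroup M] [Module ℂ M] [LieRingModule L M] [LieModule ℂ L M]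
    [LieModule.IsIrreducible ℂ L M]
    (h0 : nInv H Δ θ M ≠ ⊥) :
    (∀ W : Submodule ℂ M, W ≤ nInv H Δ θ M → W ≠ ⊥ → lStableAux H θ W →
        W = nInv H Δ θ M) ∧
    (∀ (p : LieSubalgebra ℂ L), (p : Submodule ℂ L) = par H Δ θ →
       ∀ (N : Type*) [AddCommGroup N] [Module ℂ N] [LieRingModule p N]
         [LieModule ℂ p N] (e : N ≃ₗ[ℂ] nInv H Δ θ M),
         (∀ (x : p) (n : N), (e ⁅x, n⁆ : M) = ⁅(x : L), (e n : M)⁆) →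
         ∀ (V : Type*) [AddCommGroup V] [Module ℂ V] [LieRingModule L V]
           [LieModule ℂ L V] (i : N →ₗ[ℂ] V), IsGVM p N V i →
           ∃ φ : V →ₗ⁅ℂ,L⁆ M, Function.Surjective φ ∧ ∀ n : N, φ (i n) = e n) := by
  exact ⟨fun W h1 h2 h3 => part_one H hΔ hθ W h1 h2 h3,
    fun p _ N _ _ _ _ e he V _ _ _ _ i hi => part_two (nInv H Δ θ M) h0 p N e he V i hi⟩

end Paper
end
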